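/- arXiv:1803.10129 — 3 statements merged into one kernel-verified Lean document; each statement's English description precedes it below -/
import Mathlib

section
/- The set of parameters (x₁, x₂, y₁, y₂) in D = {(x₁, x₂, y₁, y₂) ∈ ℝ⁴ : 0 ≤ x₁ < x₂ < 1 and y₁ < y₂ < y₁ + 1} for which the piecewise affine circle homeomorphism f_{x₁,x₂,y₁,y₂} with break points x₁, x₂ and images y₁, y₂ is minimal has Lebesgue measure zero in ℝ⁴. -/
open MeasureTheory Filter

/-- The circle `ℝ/ℤ`. -/
abbrev Circle1 : Type := AddCircle (1 : ℝ)

/-- `F : ℝ → ℝ` is a lift of an orientation-preserving circle homeomorphism: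
continuous, strictly increasing, commuting with the unit translation. -/
def IsLift (F : ℝ → ℝ) : Prop :=
  Continuous F ∧ StrictMono F ∧ ∀ x : ℝ, F (x + 1) = F x + 1

/-- The circle map `f` is induced by the lift `F`. -/
def Induces (F : ℝ → ℝ) (f : Circle1 → Circle1) : Prop :=
  ∀ x : ℝ, f ((x : ℝ) : Circle1) = ((F x : ℝ) : Circle1)

/-- `F` is the lift of the piecewise affine circle homeomorphism with break points
`x₁, x₂` and images `y₁, y₂`: it satisfies `F x₁ = y₁`, `F x₂ = y₂` and is affine
on `[x₁, x₂]` and on `[x₂, x₁ + 1]`. -/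
def IsPiecewiseAffineTwoBreakLift (x₁ x₂ y₁ y₂ : ℝ) (F : ℝ → ℝ) : Prop :=
  IsLift F ∧ F x₁ = y₁ ∧ F x₂ = y₂ ∧
    (∃ a b : ℝ, ∀ x ∈ Set.Icc x₁ x₂, F x = a * x + b) ∧
    (∃ a b : ℝ, ∀ x ∈ Set.Icc x₂ (x₁ + 1), F x = a * x + b)

/-- A circle homeomorphism `f` is minimal if every (two-sided) orbit
`{fⁿ(x) : n ∈ ℤ}` is dense.  For a bijection `f`, the point `y` lies on the
`ℤ`-orbit of `x` iff `f^[n] x = y` or `f^[n] y = x` for some natural `n`. -/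
def MinimalCircleMap (f : Circle1 → Circle1) : Prop :=
  ∀ x : Circle1, Dense {y : Circle1 | ∃ n : ℕ, f^[n] x = y ∨ f^[n] y = x}

open Set Topology Function

/-- `F` is a continuous degree one map of the line, affine of slope `σ₁ > 0` on `[a, b]` and of
slope `σ₂ > 0` on `[b, a + 1]`. -/
structure IsTwoBreak (a b σ₁ σ₂ : ℝ) (F : ℝ → ℝ) : Prop where
  continuous : Continuous F
  map_add_one : ∀ x, F (x + 1) = F x + 1
  lt : a < b
  lt_add_one : b < a + 1
  pos₁ : 0 < σ₁
  pos₂ : 0 < σ₂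
  eq_left : ∀ x ∈ Icc a b, F x = F a + σ₁ * (x - a)
  eq_right : ∀ x ∈ Icc b (a + 1), F x = F b + σ₂ * (x - b)

/-- The number of visits, up to time `n`, of the `F`-orbit of `x` to `[a, b)` modulo `1`. -/
noncomputable def visits (a b : ℝ) (F : ℝ → ℝ) (n : ℕ) (x : ℝ) : ℤ :=
  ∑ i ∈ Finset.range n, (⌊F^[i] x - a⌋ - ⌊F^[i] x - b⌋)

namespace IsTwoBreak

variable {a b σ₁ σ₂ : ℝ} {F : ℝ → ℝ}

theorem add_const (h : IsTwoBreak a b σ₁ σ₂ F) (c : ℝ) :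
    IsTwoBreak a b σ₁ σ₂ (fun x => F x + c) where
  continuous := h.continuous.add continuous_const
  map_add_one x := by rw [h.map_add_one]; ring
  lt := h.lt
  lt_add_one := h.lt_add_one
  pos₁ := h.pos₁
  pos₂ := h.pos₂
  eq_left x hx := by rw [h.eq_left x hx]; ring
  eq_right x hx := by rw [h.eq_right x hx]; ring

theorem conj_neg (h : IsTwoBreak a b σ₁ σ₂ F) :
    IsTwoBreak (-b) (-a) σ₁ σ₂ (fun x => -F (-x)) where
  continuous := (h.continuous.comp continuous_neg).neg
  map_add_one x := by
    have := h.map_add_one (-(x + 1))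
    rw [show -(x + 1) + 1 = -x by ring] at this
    linarith
  lt := neg_lt_neg h.lt
  lt_add_one := by linarith [h.lt_add_one]
  pos₁ := h.pos₁
  pos₂ := h.pos₂
  eq_left x hx := by
    have hx' : -x ∈ Icc a b := ⟨by linarith [hx.2], by linarith [hx.1]⟩
    rw [neg_neg, h.eq_left (-x) hx', h.eq_left b ⟨h.lt.le, le_rfl⟩]
    ring
  eq_right x hx := by
    have hx' : -x + 1 ∈ Icc b (a + 1) := ⟨by linarith [hx.2], by linarith [hx.1]⟩
    have h₁ := h.eq_right _ hx'
    have h₂ := h.eq_right (a + 1) ⟨h.lt_add_one.le, le_rfl⟩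
    rw [h.map_add_one] at h₁ h₂
    rw [neg_neg]
    linarith

theorem slope_relation (h : IsTwoBreak a b σ₁ σ₂ F) :
    σ₁ * (b - a) + σ₂ * (1 - (b - a)) = 1 := by
  have h₁ := h.eq_left b ⟨h.lt.le, le_rfl⟩
  have h₂ := h.eq_right (a + 1) ⟨h.lt_add_one.le, le_rfl⟩
  rw [h.map_add_one] at h₂
  linarith

theorem map_add_int (h : IsTwoBreak a b σ₁ σ₂ F) (x : ℝ) (n : ℤ) : F (x + n) = F x + n := by
  induction n using Int.induction_on with
  | zero => simp
  | succ i ih =>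
    push_cast at ih ⊢
    rw [← add_assoc, h.map_add_one, ih, add_assoc]
  | pred i ih =>
    push_cast at ih ⊢
    have := h.map_add_one (x + (-i - 1))
    rw [show x + (-(i : ℝ) - 1) + 1 = x + -i by ring, ih] at this
    linarith

theorem iterate_add_int (h : IsTwoBreak a b σ₁ σ₂ F) (n : ℕ) (x : ℝ) (m : ℤ) :
    F^[n] (x + m) = F^[n] x + m := by
  induction n generalizing x with
  | zero => rfl
  | succ n ih => rw [iterate_succ_apply, iterate_succ_apply, h.map_add_int, ih]

theorem iterate_sub_int (h : IsTwoBreak a b σ₁ σ₂ F) (n : ℕ) (x : ℝ) (m : ℤ) :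
    F^[n] (x - m) = F^[n] x - m := by
  simpa [sub_eq_add_neg] using h.iterate_add_int n x (-m)

theorem hasDerivWithinAt (h : IsTwoBreak a b σ₁ σ₂ F) (x : ℝ) :
    HasDerivWithinAt F (Real.exp ((Real.log σ₁ - Real.log σ₂) * ((⌊x - a⌋ - ⌊x - b⌋ : ℤ) : ℝ)
      + Real.log σ₂)) (Ici x) x := by
  set n := ⌊x - a⌋ with hn
  have hn₁ : (n : ℝ) ≤ x - a := Int.floor_le _
  have hn₂ : x - a < n + 1 := Int.lt_floor_add_one _
  have key : ∀ (c d σ : ℝ), (∀ y ∈ Icc c d, F y = F c + σ * (y - c)) → c ≤ x - n → x - n < d →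
      HasDerivWithinAt F σ (Ici x) x := by
    intro c d σ hF hc hd
    have h₁ : HasDerivWithinAt (fun y => F c + n + σ * (y - n - c)) σ (Ici x) x := by
      have := (((hasDerivAt_id x).sub_const (n : ℝ)).sub_const c).const_mul σ
      simpa using (this.const_add (F c + n)).hasDerivWithinAt
    have heq : ∀ y ∈ Ico x (d + n), F y = F c + n + σ * (y - n - c) := by
      intro y hy
      have h₂ := hF (y - n) ⟨by linarith [hy.1], by linarith [hy.2]⟩
      have h₃ := h.map_add_int (y - n) n
      rw [sub_add_cancel, h₂] at h₃
      rw [h₃]; ring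
    refine h₁.congr_of_eventuallyEq ?_ (heq x ⟨le_rfl, by linarith⟩)
    have : Ico x (d + n) ∈ 𝓝[≥] x := Ico_mem_nhdsGE (by linarith)
    filter_upwards [this] with y hy using heq y hy
  rcases lt_or_ge (x - n) b with hb | hb
  · have hfl : ⌊x - b⌋ = n - 1 := by
      rw [Int.floor_eq_iff]; push_cast; constructor <;> linarith [h.lt_add_one]
    have := key a b σ₁ h.eq_left (by linarith) hb
    rw [hfl]
    refine this.congr_deriv ?_
    push_cast
    rw [show (Real.log σ₁ - Real.log σ₂) * ((n : ℝ) - (n - 1)) + Real.log σ₂ = Real.log σ₁ by ring,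
      Real.exp_log h.pos₁]
  · have hfl : ⌊x - b⌋ = n := by
      rw [Int.floor_eq_iff]; constructor <;> linarith [h.lt]
    have := key b (a + 1) σ₂ h.eq_right hb (by linarith)
    rw [hfl]
    simpa [Real.exp_log h.pos₂] using this

theorem strictMono (h : IsTwoBreak a b σ₁ σ₂ F) : StrictMono F := by
  intro x y hxy
  set D : ℝ → ℝ := fun z => Real.exp ((Real.log σ₁ - Real.log σ₂) *
    ((⌊z - a⌋ - ⌊z - b⌋ : ℤ) : ℝ) + Real.log σ₂) with hD
  have hbd : ∀ z, min σ₁ σ₂ ≤ D z := by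
    intro z
    have h₁ : ⌊z - b⌋ ≤ ⌊z - a⌋ := Int.floor_le_floor (by linarith [h.lt])
    have h₂ : ⌊z - a⌋ ≤ ⌊z - b⌋ + 1 := by
      rw [← Int.floor_add_one]; exact Int.floor_le_floor (by linarith [h.lt_add_one])
    rcases (by omega : ⌊z - a⌋ - ⌊z - b⌋ = 0 ∨ ⌊z - a⌋ - ⌊z - b⌋ = 1) with h₃ | h₃
    · simp only [hD, h₃]; simp [Real.exp_log h.pos₂]
    · simp only [hD, h₃]; simp [Real.exp_log h.pos₁]
  have := image_le_of_deriv_right_le_deriv_boundary (f := fun z => F x + min σ₁ σ₂ * (z - x))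
    (f' := fun _ => min σ₁ σ₂) (a := x) (b := y) (by fun_prop)
    (fun z _ => by
      have := ((hasDerivAt_id z).sub_const x).const_mul (min σ₁ σ₂)
      simpa using (this.const_add (F x)).hasDerivWithinAt)
    (B := F) (B' := D) (by simp) h.continuous.continuousOn (fun z _ => h.hasDerivWithinAt z)
    (fun z _ => hbd z) (right_mem_Icc.2 hxy.le)
  have hpos : 0 < min σ₁ σ₂ * (y - x) := mul_pos (lt_min h.pos₁ h.pos₂) (sub_pos.2 hxy)
  linarith

theorem continuous_iterate (h : IsTwoBreak a b σ₁ σ₂ F) (n : ℕ) : Continuous F^[n] :=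
  h.continuous.iterate n

theorem strictMono_iterate (h : IsTwoBreak a b σ₁ σ₂ F) (n : ℕ) : StrictMono F^[n] :=
  h.strictMono.iterate n

theorem hasDerivWithinAt_iterate (h : IsTwoBreak a b σ₁ σ₂ F) (n : ℕ) (x : ℝ) :
    HasDerivWithinAt F^[n] (Real.exp ((Real.log σ₁ - Real.log σ₂) * (visits a b F n x : ℝ)
      + n * Real.log σ₂)) (Ici x) x := by
  induction n with
  | zero => simpa [visits] using hasDerivWithinAt_id x (Ici x)
  | succ n ih =>
    have hc := (h.hasDerivWithinAt (F^[n] x)).comp x ih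
      (fun y hy => (h.strictMono_iterate n).monotone hy)
    rw [← iterate_succ'] at hc
    refine hc.congr_deriv ?_
    rw [← Real.exp_add, visits, visits, Finset.sum_range_succ]
    push_cast
    ring_nf

theorem sub_le_mul_of_deriv_le (h : IsTwoBreak a b σ₁ σ₂ F) {n : ℕ} {x y c : ℝ} (hxy : x ≤ y)
    (hc : ∀ z ∈ Ico x y, Real.exp ((Real.log σ₁ - Real.log σ₂) * (visits a b F n z : ℝ)
      + n * Real.log σ₂) ≤ c) : F^[n] y - F^[n] x ≤ c * (y - x) := by
  have := image_le_of_deriv_right_le_deriv_boundary (f := F^[n]) (a := x) (b := y)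
    (h.continuous_iterate n).continuousOn (fun z _ => h.hasDerivWithinAt_iterate n z)
    (B := fun z => F^[n] x + c * (z - x)) (B' := fun _ => c) (by simp) (by fun_prop)
    (fun z _ => by
      have := ((hasDerivAt_id z).sub_const x).const_mul c
      simpa using (this.const_add (F^[n] x)).hasDerivWithinAt)
    hc (right_mem_Icc.2 hxy)
  linarith

theorem mul_le_sub_of_le_deriv (h : IsTwoBreak a b σ₁ σ₂ F) {n : ℕ} {x y c : ℝ} (hxy : x ≤ y)
    (hc : ∀ z ∈ Ico x y, c ≤ Real.exp ((Real.log σ₁ - Real.log σ₂) * (visits a b F n z : ℝ)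
      + n * Real.log σ₂)) : c * (y - x) ≤ F^[n] y - F^[n] x := by
  have := image_le_of_deriv_right_le_deriv_boundary (f := fun z => F^[n] x + c * (z - x))
    (f' := fun _ => c) (a := x) (b := y) (by fun_prop)
    (fun z _ => by
      have := ((hasDerivAt_id z).sub_const x).const_mul c
      simpa using (this.const_add (F^[n] x)).hasDerivWithinAt)
    (B := F^[n]) (by simp) (h.continuous_iterate n).continuousOn
    (fun z _ => h.hasDerivWithinAt_iterate n z) hc (right_mem_Icc.2 hxy)
  linarith

end IsTwoBreak
theorem sum_range_shift {R : Type*} [AddCommGroup R] {u : ℕ → R} {q : ℕ} {P : R}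
    (hu : ∀ i, u (i + q) = u i + P) (k : ℕ) :
    ∑ i ∈ Finset.range q, u (i + k) = ∑ i ∈ Finset.range q, u i + k • P := by
  induction k with
  | zero => simp
  | succ k ih =>
    have h₁ := Finset.sum_range_succ' (fun i => u (i + k)) q
    rw [Finset.sum_range_succ, ih] at h₁
    have h₂ : u (q + k) = u (0 + k) + P := by rw [add_comm q, hu, zero_add]
    have h₃ : ∑ i ∈ Finset.range q, u (i + 1 + k) = ∑ i ∈ Finset.range q, u (i + (k + 1)) :=
      Finset.sum_congr rfl fun i _ => by rw [add_right_comm, add_assoc]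
    rw [h₂, h₃] at h₁
    rw [succ_nsmul]
    have h₄ : (∑ i ∈ Finset.range q, u i + (k • P + P)) + u (0 + k)
        = ∑ i ∈ Finset.range q, u (i + (k + 1)) + u (0 + k) := by
      rw [← h₁]; abel
    exact (add_right_cancel h₄).symm

/-- `[z, w]` is a gap of a periodic orbit of rotation number `p / q` of `g`: its first `q` images
cover the circle exactly once. -/
structure IsGap (g : ℝ → ℝ) (q : ℕ) (p : ℤ) (z w : ℝ) : Prop where
  lt : z < w
  left : g^[q] z = z + p
  right : g^[q] w = w + p
  sum_floor : ∀ c : ℝ, ∑ i ∈ Finset.range q, (⌊g^[i] w - c⌋ - ⌊g^[i] z - c⌋) = 1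
  sum_length : ∑ i ∈ Finset.range q, (g^[i] w - g^[i] z) = 1

namespace IsTwoBreak

variable {a b σ₁ σ₂ : ℝ} {g : ℝ → ℝ}

theorem isGap (h : IsTwoBreak a b σ₁ σ₂ g) {q k : ℕ} {p l : ℤ} (hdet : l * q - k * p = 1) {w : ℝ}
    (hw : g^[q] w = w + p) : IsGap g q p (g^[k] w - l) w := by
  have hper : ∀ i, g^[i + q] w = g^[i] w + p := fun i => by
    rw [iterate_add_apply, hw, h.iterate_add_int]
  have hz : ∀ i, g^[i] (g^[k] w - l) = g^[i + k] w - l := fun i => by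
    rw [h.iterate_sub_int, iterate_add_apply]
  have hfloor : ∀ c : ℝ,
      ∑ i ∈ Finset.range q, (⌊g^[i] w - c⌋ - ⌊g^[i] (g^[k] w - l) - c⌋) = 1 := by
    intro c
    have := sum_range_shift (u := fun i => ⌊g^[i] w - c⌋) (q := q) (P := p)
      (fun i => by rw [hper, add_sub_right_comm, Int.floor_add_intCast]) k
    have h₂ : ∀ i, ⌊g^[i] (g^[k] w - l) - c⌋ = ⌊g^[i + k] w - c⌋ - l := fun i => by
      rw [hz, sub_right_comm, Int.floor_sub_intCast]
    simp only [h₂, Finset.sum_sub_distrib, this]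
    simp
    linarith
  refine ⟨?_, ?_, hw, hfloor, ?_⟩
  · by_contra hcon
    have h₁ := hfloor 0
    have h₂ : ∑ i ∈ Finset.range q, (⌊g^[i] w - 0⌋ - ⌊g^[i] (g^[k] w - l) - 0⌋) ≤ 0 := by
      refine Finset.sum_nonpos fun i _ => ?_
      have : g^[i] w ≤ g^[i] (g^[k] w - l) := (h.strictMono_iterate i).monotone (not_lt.1 hcon)
      have := Int.floor_le_floor (sub_le_sub_right this (0 : ℝ))
      linarith
    linarith
  · rw [hz, add_comm q, hper]; ring
  · have := sum_range_shift (u := fun i => g^[i] w) (q := q) (P := (p : ℝ)) hper k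
    simp only [hz, Finset.sum_sub_distrib, this]
    simp
    have : (l : ℝ) * q - k * p = 1 := by exact_mod_cast hdet
    linarith

variable {q : ℕ} {p : ℤ} {z w : ℝ}

theorem gap_sum_floor_mem (h : IsTwoBreak a b σ₁ σ₂ g) (hg : IsGap g q p z w) {i n : ℕ}
    (hin : i + n ≤ q) {x y : ℝ} (hx : z ≤ x) (hxy : x ≤ y) (hy : y ≤ w) (c : ℝ) :
    ∑ j ∈ Finset.range n, (⌊g^[j + i] y - c⌋ - ⌊g^[j + i] x - c⌋) ∈ Icc (0 : ℤ) 1 := by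
  have hmono : ∀ {x y : ℝ}, x ≤ y → ∀ j, ⌊g^[j] x - c⌋ ≤ ⌊g^[j] y - c⌋ := fun hxy j =>
    Int.floor_le_floor (sub_le_sub_right ((h.strictMono_iterate j).monotone hxy) c)
  refine ⟨Finset.sum_nonneg fun j _ => sub_nonneg.2 (hmono hxy _), ?_⟩
  calc ∑ j ∈ Finset.range n, (⌊g^[j + i] y - c⌋ - ⌊g^[j + i] x - c⌋)
      ≤ ∑ j ∈ Finset.range n, (⌊g^[i + j] w - c⌋ - ⌊g^[i + j] z - c⌋) := by
        refine Finset.sum_le_sum fun j _ => ?_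
        rw [add_comm j i]
        have := hmono hx (i + j)
        have := hmono hy (i + j)
        linarith
    _ = ∑ j ∈ Finset.Ico i (i + n), (⌊g^[j] w - c⌋ - ⌊g^[j] z - c⌋) := by
        rw [Finset.sum_Ico_eq_sum_range, Nat.add_sub_cancel_left]
    _ ≤ ∑ j ∈ Finset.range q, (⌊g^[j] w - c⌋ - ⌊g^[j] z - c⌋) := by
        refine Finset.sum_le_sum_of_subset_of_nonneg ?_
          fun j _ _ => sub_nonneg.2 (hmono hg.lt.le _)
        intro j hj
        rw [Finset.mem_Ico] at hj
        rw [Finset.mem_range]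
        omega
    _ = 1 := hg.sum_floor c

theorem abs_visits_sub_le (h : IsTwoBreak a b σ₁ σ₂ g) (hg : IsGap g q p z w) {i n : ℕ}
    (hin : i + n ≤ q) {u : ℝ} (hu : u ∈ Icc (g^[i] z) (g^[i] w)) :
    |(visits a b g n u : ℝ) - visits a b g n (g^[i] z)| ≤ 1 := by
  obtain ⟨x, hx, rfl⟩ := intermediate_value_Icc hg.lt.le (h.continuous_iterate i).continuousOn hu
  have h₁ := h.gap_sum_floor_mem hg hin le_rfl hx.1 hx.2 a
  have h₂ := h.gap_sum_floor_mem hg hin le_rfl hx.1 hx.2 b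
  have h₃ : visits a b g n (g^[i] x) - visits a b g n (g^[i] z) =
      ∑ j ∈ Finset.range n, (⌊g^[j + i] x - a⌋ - ⌊g^[j + i] z - a⌋) -
      ∑ j ∈ Finset.range n, (⌊g^[j + i] x - b⌋ - ⌊g^[j + i] z - b⌋) := by
    simp only [visits, ← iterate_add_apply, ← Finset.sum_sub_distrib]
    exact Finset.sum_congr rfl fun j _ => by ring
  have h₄ : |visits a b g n (g^[i] x) - visits a b g n (g^[i] z)| ≤ 1 := by
    rw [h₃, abs_le]
    constructor <;> linarith [h₁.1, h₁.2, h₂.1, h₂.2]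
  exact_mod_cast h₄

theorem gap_deriv_bounds (h : IsTwoBreak a b σ₁ σ₂ g) (hg : IsGap g q p z w) {i n : ℕ}
    (hin : i + n = q) : ∃ D > 0, ∀ u v, g^[i] z ≤ u → u ≤ v → v ≤ g^[i] w →
      g^[n] v - g^[n] u ≤ Real.exp |Real.log σ₁ - Real.log σ₂| * D * (v - u) ∧
      Real.exp (-|Real.log σ₁ - Real.log σ₂|) * D * (v - u) ≤ g^[n] v - g^[n] u := by
  set s := Real.log σ₁ - Real.log σ₂ with hs
  refine ⟨Real.exp (s * visits a b g n (g^[i] z) + n * Real.log σ₂), Real.exp_pos _, ?_⟩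
  intro u v hu huv hv
  have key : ∀ x ∈ Ico u v, |s * (visits a b g n x : ℝ) - s * visits a b g n (g^[i] z)| ≤ |s| := by
    intro x hx
    have := h.abs_visits_sub_le hg hin.le (u := x) ⟨hu.trans hx.1, hx.2.le.trans hv⟩
    rw [← mul_sub, abs_mul]
    exact mul_le_of_le_one_right (abs_nonneg _) this
  rw [← Real.exp_add, ← Real.exp_add]
  refine ⟨h.sub_le_mul_of_deriv_le huv fun x hx => ?_, h.mul_le_sub_of_le_deriv huv fun x hx => ?_⟩
  · have := (abs_le.1 (key x hx)).2
    exact Real.exp_le_exp.2 (by linarith)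
  · have := (abs_le.1 (key x hx)).1
    exact Real.exp_le_exp.2 (by linarith)

theorem gap_distortion (h : IsTwoBreak a b σ₁ σ₂ g) (hg : IsGap g q p z w) {i n : ℕ}
    (hin : i + n = q) {u v : ℝ} (hu : g^[i] z ≤ u) (huv : u ≤ v) (hv : v ≤ g^[i] w) :
    (g^[n] v - g^[n] u) * (g^[i] w - g^[i] z)
      ≤ Real.exp (2 * |Real.log σ₁ - Real.log σ₂|) * (w - z) * (v - u) ∧
    (w - z) * (v - u) ≤ Real.exp (2 * |Real.log σ₁ - Real.log σ₂|) *
      ((g^[n] v - g^[n] u) * (g^[i] w - g^[i] z)) := by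
  obtain ⟨D, hD, hbd⟩ := h.gap_deriv_bounds hg hin
  have hlen : g^[n] (g^[i] w) - g^[n] (g^[i] z) = w - z := by
    rw [← iterate_add_apply, ← iterate_add_apply, add_comm n, hin, hg.left, hg.right]; ring
  have hle := (h.strictMono_iterate i).monotone hg.lt.le
  obtain ⟨h₁, h₂⟩ := hbd u v hu huv hv
  obtain ⟨h₃, h₄⟩ := hbd _ _ le_rfl hle le_rfl
  rw [hlen] at h₃ h₄
  have hE : Real.exp (2 * |Real.log σ₁ - Real.log σ₂|) =
    Real.exp |Real.log σ₁ - Real.log σ₂| * Real.exp |Real.log σ₁ - Real.log σ₂| := by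
    rw [← Real.exp_add]; ring_nf
  rw [Real.exp_neg] at h₂ h₄
  rw [hE]
  have hE0 := Real.exp_pos |Real.log σ₁ - Real.log σ₂|
  generalize Real.exp |Real.log σ₁ - Real.log σ₂| = E at *
  have hvu : 0 ≤ v - u := sub_nonneg.2 huv
  have hL : 0 ≤ g^[i] w - g^[i] z := sub_nonneg.2 hle
  have hinv : E * E⁻¹ = 1 := mul_inv_cancel₀ hE0.ne'
  constructor
  · calc (g^[n] v - g^[n] u) * (g^[i] w - g^[i] z)
        ≤ E * D * (v - u) * (g^[i] w - g^[i] z) := mul_le_mul_of_nonneg_right h₁ hL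
      _ = E * E * (E⁻¹ * D * (g^[i] w - g^[i] z)) * (v - u) := by
        linear_combination (-E * D * (v - u) * (g^[i] w - g^[i] z)) * hinv
      _ ≤ E * E * (w - z) * (v - u) := by gcongr
  · calc (w - z) * (v - u) ≤ E * D * (g^[i] w - g^[i] z) * (v - u) :=
        mul_le_mul_of_nonneg_right h₃ hvu
      _ = E * E * ((E⁻¹ * D * (v - u)) * (g^[i] w - g^[i] z)) := by
        linear_combination (-E * D * (v - u) * (g^[i] w - g^[i] z)) * hinv
      _ ≤ E * E * ((g^[n] v - g^[n] u) * (g^[i] w - g^[i] z)) := by gcongr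

end IsTwoBreak

theorem half_le_abs_exp_sub_one {e x : ℝ} (he : 0 ≤ e) (he1 : e ≤ 1) (hx : e ≤ |x|) :
    e / 2 ≤ |Real.exp x - 1| := by
  rcases le_total 0 x with h | h
  · rw [abs_of_nonneg h] at hx
    have := Real.add_one_le_exp x
    exact le_abs.2 (Or.inl (by linarith))
  · rw [abs_of_nonpos h] at hx
    have h₁ : Real.exp x ≤ Real.exp (-e) := Real.exp_le_exp.2 (by linarith)
    have h₂ := Real.add_one_le_exp e
    have h₃ : Real.exp (-e) * Real.exp e = 1 := by rw [← Real.exp_add]; simp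
    have h₄ := Real.exp_pos (-e)
    refine le_abs.2 (Or.inr ?_)
    nlinarith

namespace IsTwoBreak

variable {a b σ₁ σ₂ : ℝ} {g : ℝ → ℝ} {q : ℕ} {p : ℤ} {z w : ℝ}

/-- The displacement of `g^[q]` on an interval without breaks. -/
theorem exists_displacement_of_floor_eq (h : IsTwoBreak a b σ₁ σ₂ g)
    (hge : ∀ x, x + p ≤ g^[q] x) {e : ℝ} (he : 0 ≤ e) (he1 : e ≤ 1)
    (hres : ∀ N : ℤ, e ≤ |(Real.log σ₁ - Real.log σ₂) * N + q * Real.log σ₂|) {u v : ℝ}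
    (huv : u ≤ v)
    (hua : ∑ j ∈ Finset.range q, ⌊g^[j] u - a⌋ = ∑ j ∈ Finset.range q, ⌊g^[j] v - a⌋)
    (hub : ∑ j ∈ Finset.range q, ⌊g^[j] u - b⌋ = ∑ j ∈ Finset.range q, ⌊g^[j] v - b⌋) :
    ∃ y ∈ Icc u v, e / 2 * (v - u) ≤ g^[q] y - y - p := by
  have hmono : ∀ (c : ℝ) {x y : ℝ}, x ≤ y →
      ∑ j ∈ Finset.range q, ⌊g^[j] x - c⌋ ≤ ∑ j ∈ Finset.range q, ⌊g^[j] y - c⌋ :=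
    fun c x y hxy => Finset.sum_le_sum fun j _ =>
      Int.floor_le_floor (sub_le_sub_right ((h.strictMono_iterate j).monotone hxy) c)
  have hconst : ∀ x ∈ Ico u v, visits a b g q x = visits a b g q u := by
    intro x hx
    have h₁ := hmono a hx.1
    have h₂ := hmono a hx.2.le
    have h₃ := hmono b hx.1
    have h₄ := hmono b hx.2.le
    simp only [visits, Finset.sum_sub_distrib]
    omega
  have hC := half_le_abs_exp_sub_one he he1 (hres (visits a b g q u))
  have h₁ := h.sub_le_mul_of_deriv_le huv fun x hx => by rw [hconst x hx]
  have h₂ := h.mul_le_sub_of_le_deriv huv fun x hx => by rw [hconst x hx]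
  generalize Real.exp ((Real.log σ₁ - Real.log σ₂) * (visits a b g q u : ℝ)
    + q * Real.log σ₂) = C at *
  have h₃ := hge u
  have h₄ := hge v
  rcases le_abs.1 hC with h₅ | h₅
  · refine ⟨v, right_mem_Icc.2 huv, ?_⟩
    nlinarith [mul_le_mul_of_nonneg_right h₅ (sub_nonneg.2 huv)]
  · refine ⟨u, left_mem_Icc.2 huv, ?_⟩
    nlinarith [mul_le_mul_of_nonneg_right h₅ (sub_nonneg.2 huv)]

theorem exists_large_displacement (h : IsTwoBreak a b σ₁ σ₂ g) (hg : IsGap g q p z w)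
    (hge : ∀ x, x + p ≤ g^[q] x) {e : ℝ} (he : 0 ≤ e) (he1 : e ≤ 1)
    (hres : ∀ N : ℤ, e ≤ |(Real.log σ₁ - Real.log σ₂) * N + q * Real.log σ₂|) :
    ∃ y ∈ Icc z w, e / 6 * (w - z) ≤ g^[q] y - y - p := by
  set d := (w - z) / 3 with hd
  have hdpos : 0 < d := by have := hg.lt; rw [hd]; linarith
  have hmono : ∀ (c : ℝ) {x y : ℝ}, x ≤ y →
      ∑ j ∈ Finset.range q, ⌊g^[j] x - c⌋ ≤ ∑ j ∈ Finset.range q, ⌊g^[j] y - c⌋ :=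
    fun c x y hxy => Finset.sum_le_sum fun j _ =>
      Int.floor_le_floor (sub_le_sub_right ((h.strictMono_iterate j).monotone hxy) c)
  have hjump := hg.sum_floor
  simp only [Finset.sum_sub_distrib] at hjump
  have piece : ∃ u, z ≤ u ∧ u + d ≤ w ∧
      ∑ j ∈ Finset.range q, ⌊g^[j] u - a⌋ = ∑ j ∈ Finset.range q, ⌊g^[j] (u + d) - a⌋ ∧
      ∑ j ∈ Finset.range q, ⌊g^[j] u - b⌋ = ∑ j ∈ Finset.range q, ⌊g^[j] (u + d) - b⌋ := by
    have e₃ : z + d + d + d = w := by rw [hd]; ring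
    have ha := hjump a
    have hb := hjump b
    rw [← e₃] at ha hb
    have ha₁ := hmono a (by linarith : z ≤ z + d)
    have ha₂ := hmono a (by linarith : z + d ≤ z + d + d)
    have ha₃ := hmono a (by linarith : z + d + d ≤ z + d + d + d)
    have hb₁ := hmono b (by linarith : z ≤ z + d)
    have hb₂ := hmono b (by linarith : z + d ≤ z + d + d)
    have hb₃ := hmono b (by linarith : z + d + d ≤ z + d + d + d)
    by_cases c₁ : ∑ j ∈ Finset.range q, ⌊g^[j] z - a⌋ = ∑ j ∈ Finset.range q, ⌊g^[j] (z + d) - a⌋ ∧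
      ∑ j ∈ Finset.range q, ⌊g^[j] z - b⌋ = ∑ j ∈ Finset.range q, ⌊g^[j] (z + d) - b⌋
    · exact ⟨z, le_rfl, by linarith, c₁⟩
    by_cases c₂ : ∑ j ∈ Finset.range q, ⌊g^[j] (z + d) - a⌋
        = ∑ j ∈ Finset.range q, ⌊g^[j] (z + d + d) - a⌋ ∧
      ∑ j ∈ Finset.range q, ⌊g^[j] (z + d) - b⌋ = ∑ j ∈ Finset.range q, ⌊g^[j] (z + d + d) - b⌋
    · exact ⟨z + d, by linarith, by linarith, c₂⟩
    · refine ⟨z + d + d, by linarith, by linarith, ?_, ?_⟩ <;> omega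
  obtain ⟨u, hu, hv, hua, hub⟩ := piece
  obtain ⟨y, hy, hyd⟩ := h.exists_displacement_of_floor_eq hge he he1 hres
    (by linarith : u ≤ u + d) hua hub
  refine ⟨y, ⟨hu.trans hy.1, hy.2.trans hv⟩, le_of_eq_of_le ?_ hyd⟩
  rw [hd]; ring

end IsTwoBreak
namespace IsTwoBreak

variable {a b σ₁ σ₂ : ℝ} {g F : ℝ → ℝ} {q : ℕ} {p : ℤ} {z w : ℝ}

theorem sub_const (h : IsTwoBreak a b σ₁ σ₂ F) (c : ℝ) :
    IsTwoBreak a b σ₁ σ₂ (fun x => F x - c) := by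
  simpa only [sub_eq_add_neg] using h.add_const (-c)

theorem iterate_le_iterate_of_sub_const (h : IsTwoBreak a b σ₁ σ₂ F) {c d : ℝ} (hcd : c ≤ d)
    (n : ℕ) (x : ℝ) : (fun x => F x - d)^[n] x ≤ (fun x => F x - c)^[n] x :=
  (h.sub_const d).strictMono.monotone.iterate_le_of_le (fun _ => sub_le_sub_left hcd _) n x

theorem le_iterate_sub_of_add_const (h : IsTwoBreak a b σ₁ σ₂ g) (hg : IsGap g q p z w) {r : ℝ}
    (hr : 0 ≤ r) {x : ℝ} (hx : z ≤ x) (hxw : (fun x => g x + r)^[q] x ≤ w + p) :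
    r * (∑ i ∈ Finset.range q, (g^[i + 1] w - g^[i + 1] z)⁻¹) * (w - z) ≤
      Real.exp (2 * |Real.log σ₁ - Real.log σ₂|) *
        ((fun x => g x + r)^[q] x - g^[q] x) := by
  set f : ℝ → ℝ := fun x => g x + r with hf
  have hgf : ∀ n y, g^[n] y ≤ f^[n] y := fun n y =>
    h.strictMono.monotone.iterate_le_of_le (fun y => by simp [hf, hr]) n y
  have htel := Finset.sum_range_sub (fun j => g^[q - j] (f^[j] x)) q
  simp only [Nat.sub_self, iterate_zero, id_eq, Nat.sub_zero] at htel
  rw [← htel, Finset.mul_sum, Finset.sum_mul, Finset.mul_sum]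
  refine Finset.sum_le_sum fun i hi => ?_
  rw [Finset.mem_range] at hi
  obtain ⟨n, rfl⟩ : ∃ n, q = i + 1 + n := ⟨q - (i + 1), by omega⟩
  rw [show i + 1 + n - (i + 1) = n by omega, show i + 1 + n - i = n + 1 by omega,
    iterate_succ_apply g n]
  have hv : f^[i + 1] x = g (f^[i] x) + r := iterate_succ_apply' f i x
  have hlow : g^[i + 1] z ≤ g (f^[i] x) := by
    rw [iterate_succ_apply']
    exact h.strictMono.monotone (((h.strictMono_iterate i).monotone hx).trans (hgf i x))
  have hup : f^[i + 1] x ≤ g^[i + 1] w := by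
    rw [← (h.strictMono_iterate n).le_iff_le, ← iterate_add_apply, add_comm n, hg.right]
    refine (hgf n _).trans ?_
    rwa [← iterate_add_apply, add_comm n]
  have hd := (h.gap_distortion hg rfl hlow (by linarith) hup).2
  have hL : 0 < g^[i + 1] w - g^[i + 1] z := sub_pos.2 (h.strictMono_iterate _ hg.lt)
  rw [show f^[i + 1] x - g (f^[i] x) = r by rw [hv]; ring, ← mul_assoc] at hd
  rw [mul_right_comm, ← div_eq_mul_inv, div_le_iff₀ hL]
  linarith

theorem iterate_sub_le_of_sub_const (h : IsTwoBreak a b σ₁ σ₂ g) (hg : IsGap g q p z w) {r : ℝ}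
    (hr : 0 ≤ r) {x : ℝ} (hx : x ≤ w) (hxz : z + p ≤ (fun x => g x - r)^[q] x) :
    g^[q] x - (fun x => g x - r)^[q] x ≤ Real.exp (2 * |Real.log σ₁ - Real.log σ₂|) *
      (r * (∑ i ∈ Finset.range q, (g^[i + 1] w - g^[i + 1] z)⁻¹) * (w - z)) := by
  set f : ℝ → ℝ := fun x => g x - r with hf
  have hgf : ∀ n y, f^[n] y ≤ g^[n] y := fun n y =>
    (h.sub_const r).strictMono.monotone.iterate_le_of_le (fun y => by simp [hr]) n y
  have htel := Finset.sum_range_sub' (fun j => g^[q - j] (f^[j] x)) q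
  simp only [Nat.sub_self, iterate_zero, id_eq, Nat.sub_zero] at htel
  rw [← htel, Finset.mul_sum, Finset.sum_mul, Finset.mul_sum]
  refine Finset.sum_le_sum fun i hi => ?_
  rw [Finset.mem_range] at hi
  obtain ⟨n, rfl⟩ : ∃ n, q = i + 1 + n := ⟨q - (i + 1), by omega⟩
  rw [show i + 1 + n - (i + 1) = n by omega, show i + 1 + n - i = n + 1 by omega,
    iterate_succ_apply g n]
  have hv : f^[i + 1] x = g (f^[i] x) - r := iterate_succ_apply' f i x
  have hup : g (f^[i] x) ≤ g^[i + 1] w := by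
    rw [iterate_succ_apply']
    exact h.strictMono.monotone ((hgf i x).trans ((h.strictMono_iterate i).monotone hx))
  have hlow : g^[i + 1] z ≤ f^[i + 1] x := by
    rw [← (h.strictMono_iterate n).le_iff_le, ← iterate_add_apply, add_comm n, hg.left]
    refine le_trans ?_ (hgf n _)
    rwa [← iterate_add_apply, add_comm n]
  have hd := (h.gap_distortion hg rfl hlow (by linarith) hup).1
  have hL : 0 < g^[i + 1] w - g^[i + 1] z := sub_pos.2 (h.strictMono_iterate _ hg.lt)
  rw [show g (f^[i] x) - f^[i + 1] x = r by rw [hv]; ring] at hd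
  rw [mul_right_comm r, ← div_eq_mul_inv, mul_div_assoc', le_div_iff₀ hL]
  linarith

theorem le_gap_sum_inv (h : IsTwoBreak a b σ₁ σ₂ g) (hg : IsGap g q p z w) :
    (q : ℝ) ≤ ∑ i ∈ Finset.range q, (g^[i + 1] w - g^[i + 1] z)⁻¹ := by
  have hpos : ∀ i, 0 < g^[i] w - g^[i] z := fun i => sub_pos.2 (h.strictMono_iterate _ hg.lt)
  have hle : ∀ i < q, g^[i] w - g^[i] z ≤ 1 := fun i hi =>
    (Finset.single_le_sum (f := fun i => g^[i] w - g^[i] z) (fun j _ => (hpos j).le)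
      (Finset.mem_range.2 hi)).trans hg.sum_length.le
  have : ∑ i ∈ Finset.range q, (1 : ℝ) ≤
      ∑ i ∈ Finset.range q, (g^[i + 1] w - g^[i + 1] z)⁻¹ := by
    refine Finset.sum_le_sum fun i hi => (one_le_inv₀ (hpos _)).2 ?_
    rw [Finset.mem_range] at hi
    rcases (by omega : i + 1 < q ∨ i + 1 = q) with h₁ | h₁
    · exact hle _ h₁
    · rw [h₁, hg.left, hg.right]
      have := hle 0 (by omega)
      simp only [iterate_zero, id_eq] at this
      linarith
  simpa using this

theorem continuous_iterate_sub_const (h : IsTwoBreak a b σ₁ σ₂ F) (n : ℕ) :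
    Continuous fun y : ℝ × ℝ => (fun x => F x - y.1)^[n] y.2 := by
  induction n with
  | zero => exact continuous_snd
  | succ n ih =>
    simp only [iterate_succ_apply']
    exact (h.continuous.comp ih).sub continuous_fst

theorem iterate_sub_natCast (h : IsTwoBreak a b σ₁ σ₂ F) (M n : ℕ) (x : ℝ) :
    (fun x => F x - M)^[n] x = F^[n] x - n * M := by
  induction n with
  | zero => simp
  | succ n ih =>
    have := h.map_add_int (F^[n] x) (-(n * M : ℤ))
    push_cast at this
    rw [iterate_succ_apply', iterate_succ_apply', ih, sub_eq_add_neg (F^[n] x), this]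
    push_cast
    ring

theorem exists_iterate_sub_natCast_le (h : IsTwoBreak a b σ₁ σ₂ F) (hq : 0 < q) (x y : ℝ) :
    ∃ M : ℕ, (fun x => F x - M)^[q] x ≤ y := by
  obtain ⟨M, hM⟩ := exists_nat_ge (F^[q] x - y)
  refine ⟨M, ?_⟩
  rw [h.iterate_sub_natCast]
  have h₁ : (1 : ℝ) ≤ q := by exact_mod_cast hq
  nlinarith [(Nat.cast_nonneg M : (0 : ℝ) ≤ M)]

/-- If `F^[q]` moves every point by more than `p`, then lowering `F` by a suitable constant makes
the displacement of its `q`-th iterate minimal equal to `p`. -/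
theorem exists_tangent (h : IsTwoBreak a b σ₁ σ₂ F) (hq : 0 < q) (hF : ∀ x, x + p < F^[q] x) :
    ∃ r ≥ 0, ∃ x₀, (fun x => F x - r)^[q] x₀ = x₀ + p ∧ ∀ x, x + p ≤ (fun x => F x - r)^[q] x := by
  obtain ⟨M, hM⟩ := h.exists_iterate_sub_natCast_le hq 0 (0 + p)
  set K : Set (ℝ × ℝ) := (Icc 0 (M : ℝ) ×ˢ Icc 0 1) ∩
    {y | (fun x => F x - y.1)^[q] y.2 ≤ y.2 + p} with hK
  have hKc : IsCompact K := (isCompact_Icc.prod isCompact_Icc).inter_right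
    (isClosed_le (h.continuous_iterate_sub_const q) (by fun_prop))
  have hKne : K.Nonempty := ⟨((M : ℝ), 0), by simpa [hK] using hM⟩
  obtain ⟨⟨r, x₀⟩, hmem, hmin⟩ := hKc.exists_isMinOn hKne continuous_fst.continuousOn
  have hr : r ∈ Icc 0 (M : ℝ) := hmem.1.1
  have hx₀ : (fun x => F x - r)^[q] x₀ ≤ x₀ + p := hmem.2
  have hge : ∀ x, x + p ≤ (fun x => F x - r)^[q] x := by
    intro x
    by_contra! hcon
    have hcont : Continuous fun τ => (fun x => F x - τ)^[q] x :=
      (h.continuous_iterate_sub_const q).comp (continuous_id.prodMk continuous_const)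
    obtain ⟨τ, hτ, hτx⟩ := intermediate_value_Icc' hr.1 hcont.continuousOn
      ⟨hcon.le, by simpa using (hF x).le⟩
    simp only at hτx
    have hfr : (τ, Int.fract x) ∈ K := by
      refine ⟨⟨⟨hτ.1, hτ.2.trans hr.2⟩, Int.fract_nonneg x, (Int.fract_lt_one x).le⟩, ?_⟩
      have := (h.sub_const τ).iterate_sub_int q x ⌊x⌋
      rw [hτx] at this
      change (fun x => F x - τ)^[q] (x - ⌊x⌋) ≤ x - ⌊x⌋ + p
      rw [this]
      linarith
    have hle : r ≤ τ := hmin hfr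
    have : τ = r := le_antisymm hτ.2 hle
    rw [this] at hτx
    exact hcon.ne hτx
  exact ⟨r, hr.1, x₀, le_antisymm hx₀ (hge x₀), hge⟩

theorem tangent_distance_le (h : IsTwoBreak a b σ₁ σ₂ g) (hg : IsGap g q p z w) {r : ℝ}
    (hr : 0 ≤ r) (hge : ∀ x, x + p ≤ g^[q] x) {m : ℕ}
    (hm : (fun x => g x + r)^[m * q] z ≤ w + m * p) :
    m * (r * ∑ i ∈ Finset.range q, (g^[i + 1] w - g^[i + 1] z)⁻¹) ≤
      Real.exp (2 * |Real.log σ₁ - Real.log σ₂|) := by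
  set f : ℝ → ℝ := fun x => g x + r with hf
  have hfb : IsTwoBreak a b σ₁ σ₂ f := h.add_const r
  set S := ∑ i ∈ Finset.range q, (g^[i + 1] w - g^[i + 1] z)⁻¹ with hS
  have hE0 := Real.exp_pos (2 * |Real.log σ₁ - Real.log σ₂|)
  have hgrow := fun x => h.le_iterate_sub_of_add_const hg hr (x := x)
  rw [← hf, ← hS] at hgrow
  generalize Real.exp (2 * |Real.log σ₁ - Real.log σ₂|) = E at *
  have hfge : ∀ x, x + p ≤ f^[q] x := fun x => (hge x).trans
    (h.strictMono.monotone.iterate_le_of_le (fun y => by simp [hf, hr]) q x)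
  set X : ℕ → ℝ := fun j => f^[j * q] z - j * p with hX
  have hstep : ∀ j, X (j + 1) = f^[q] (X j) - p := by
    intro j
    have := hfb.iterate_sub_int q (f^[j * q] z) (j * p)
    push_cast at this
    simp only [hX]
    rw [this, ← iterate_add_apply, show (j + 1) * q = q + j * q by ring]
    push_cast
    ring
  have hmono : Monotone X := monotone_nat_of_le_succ fun j => by
    rw [hstep]; linarith [hfge (X j)]
  have hX0 : X 0 = z := by simp [hX]
  have hind : ∀ j ≤ m, E * z + j * (r * S * (w - z)) ≤ E * X j := by
    intro j
    induction j with
    | zero => intro _; simp [hX0]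
    | succ j ih =>
      intro hj
      have h₁ := ih (by omega)
      have h₂ : z ≤ X j := hX0.symm.le.trans (hmono (Nat.zero_le j))
      have h₃ : X (j + 1) ≤ w := (hmono hj).trans (by simp only [hX]; linarith)
      have h₄ := hgrow (X j) h₂ (by rw [hstep] at h₃; linarith)
      have h₅ := mul_le_mul_of_nonneg_left (hge (X j)) hE0.le
      rw [hstep]
      push_cast
      linarith
  have h₁ := hind m le_rfl
  have h₂ : X m ≤ w := by simp only [hX]; linarith
  have h₃ := mul_le_mul_of_nonneg_left h₂ hE0.le
  have h₄ : m * (r * S) * (w - z) ≤ E * (w - z) := by linarith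
  exact le_of_mul_le_mul_right h₄ (sub_pos.2 hg.lt)

/-- Near a map with `p / q < rotation number < (l + m p) / (k + m q)`, the interval of translates
with a `p / q`-periodic point is long compared to its distance to the map. -/
theorem exists_locked_interval (h : IsTwoBreak a b σ₁ σ₂ F) {k m : ℕ} {l : ℤ} (hq : 0 < q)
    (hm : 0 < m) (hdet : l * q - k * p = 1) (hlow : ∀ x, x + p < F^[q] x)
    (hup : ∀ x, F^[k + m * q] x < x + (l + m * p)) {e : ℝ} (he : 0 ≤ e) (he1 : e ≤ 1)
    (hres : ∀ N : ℤ, e ≤ |(Real.log σ₁ - Real.log σ₂) * N + q * Real.log σ₂|) :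
    ∃ R > 0, R ≤ Real.exp (2 * |Real.log σ₁ - Real.log σ₂|) / q ∧ ∃ r, 0 ≤ r ∧ r ≤ R ∧
      ∀ τ ∈ Icc r (r + m * e * R / (6 * Real.exp (2 * |Real.log σ₁ - Real.log σ₂|) ^ 2)),
        ∃ x, (fun x => F x - τ)^[q] x = x + p := by
  obtain ⟨r, hr, w, hw, hge⟩ := h.exists_tangent hq hlow
  set g : ℝ → ℝ := fun x => F x - r with hgdef
  have hgb : IsTwoBreak a b σ₁ σ₂ g := h.sub_const r
  have hg := hgb.isGap hdet hw
  set z := g^[k] w - l with hz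
  have hFg : (fun x => g x + r) = F := by funext x; simp [hgdef]
  have hm' : (fun x => g x + r)^[m * q] z ≤ w + m * p := by
    rw [hFg]
    by_contra! hcon
    have h₁ := hup z
    have h₂ := (h.strictMono_iterate k).monotone hcon.le
    have h₃ := h.iterate_add_int k w (m * p)
    push_cast at h₃
    rw [h₃, ← iterate_add_apply] at h₂
    have h₄ : g^[k] w ≤ F^[k] w :=
      hgb.strictMono.monotone.iterate_le_of_le (fun y => by simp [hgdef, hr]) k w
    rw [hz] at h₁ h₂
    linarith
  have hdist := hgb.tangent_distance_le hg hr hge hm'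
  have hSq := hgb.le_gap_sum_inv hg
  obtain ⟨y, hy, hyd⟩ := hgb.exists_large_displacement hg hge he he1 hres
  have hdrop := fun c hc => hgb.iterate_sub_le_of_sub_const hg (r := c) hc hy.2
  have hE0 := Real.exp_pos (2 * |Real.log σ₁ - Real.log σ₂|)
  generalize Real.exp (2 * |Real.log σ₁ - Real.log σ₂|) = E at *
  generalize ∑ i ∈ Finset.range q, (g^[i + 1] w - g^[i + 1] z)⁻¹ = S at *
  have hq' : (0 : ℝ) < q := by exact_mod_cast hq
  have hm1 : (1 : ℝ) ≤ m := by exact_mod_cast hm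
  have hm0 : (0 : ℝ) < m := by linarith
  have hS0 : 0 < S := hq'.trans_le hSq
  obtain ⟨M, hM⟩ := hgb.exists_iterate_sub_natCast_le hq y (y + p)
  have hcont : Continuous fun τ => (fun x => g x - τ)^[q] y :=
    (hgb.continuous_iterate_sub_const q).comp (continuous_id.prodMk continuous_const)
  obtain ⟨c, hc, hcy⟩ := intermediate_value_Icc' (Nat.cast_nonneg M) hcont.continuousOn
    ⟨hM, by simpa using hge y⟩
  simp only at hcy
  have hc' := hdrop c hc.1 (by rw [hcy]; linarith [hy.1])
  rw [hcy] at hc'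
  have hce : e / 6 ≤ E * (c * S) := by
    refine le_of_mul_le_mul_right ?_ (sub_pos.2 hg.lt)
    linarith
  refine ⟨E / (m * S), by positivity, ?_, r, hr, ?_, ?_⟩
  · gcongr
    nlinarith
  · rw [le_div_iff₀ (by positivity)]; linarith
  · have hlen : m * e * (E / (m * S)) / (6 * E ^ 2) ≤ c := by
      have : m * e * (E / (m * S)) / (6 * E ^ 2) = e / 6 / (E * S) := by field_simp
      rw [this, div_le_iff₀ (by positivity)]
      linarith
    intro τ hτ
    have hτb := h.sub_const τ
    have h₁ : (fun x => F x - τ)^[q] w ≤ w + p :=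
      (h.iterate_le_iterate_of_sub_const hτ.1 q w).trans hw.le
    have h₂ : y + p ≤ (fun x => F x - τ)^[q] y := by
      have := h.iterate_le_iterate_of_sub_const (by linarith [hτ.2] : τ ≤ r + c) q y
      refine le_trans (le_of_eq ?_) this
      rw [← hcy]
      congr 1
      funext x
      simp only [hgdef]
      ring
    obtain ⟨x, hx⟩ := mem_range_of_exists_le_of_exists_ge
      ((hτb.continuous_iterate q).sub continuous_id) (c := (p : ℝ))
      ⟨w, by simp; linarith⟩ ⟨y, by simp; linarith⟩
    refine ⟨x, ?_⟩
    have hx' : (fun x => F x - τ)^[q] x - x = p := hx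
    linarith

end IsTwoBreak
/-- Two consecutive continued fraction convergents `l / k` and `p / q` of `α`. -/
structure ConvergentPair (α : ℝ) where
  (k q : ℕ)
  (l p : ℤ)
  q_pos : 0 < q
  abs_lt_one : |q * α - p| < 1
  alternate : ((p : ℝ) < q * α ∧ q * α - p < l - k * α ∧ l * q - k * p = 1) ∨
    (q * α < p ∧ p - q * α < k * α - l ∧ k * p - l * q = 1)

namespace ConvergentPair

variable {α : ℝ}

/-- The first pair of convergents, `1 / 0` and `⌊α⌋ / 1`. -/
noncomputable def initial (hα : Irrational α) : ConvergentPair α where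
  k := 0
  q := 1
  l := 1
  p := ⌊α⌋
  q_pos := one_pos
  abs_lt_one := by
    have h₁ := Int.floor_le α
    have h₂ := Int.lt_floor_add_one α
    rw [abs_lt]; push_cast; constructor <;> linarith
  alternate := by
    have h₁ := (Int.floor_le α).lt_of_ne (hα.ne_int _).symm
    have h₂ := Int.lt_floor_add_one α
    left
    push_cast
    refine ⟨by linarith, by linarith, by ring⟩

theorem exists_pos_nat_mul_lt {x y : ℝ} (hx : 0 < x) (hxy : x < y)
    (hne : ∀ n : ℕ, 0 < n → n * x ≠ y) : ∃ n : ℕ, 0 < n ∧ n * x < y ∧ y - n * x < x := by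
  have h₁ : 0 < ⌊y / x⌋₊ := Nat.floor_pos.2 ((one_le_div hx).2 hxy.le)
  have h₂ := Nat.floor_le (div_nonneg (hx.trans hxy).le hx.le)
  have h₃ := Nat.lt_floor_add_one (y / x)
  rw [le_div_iff₀ hx] at h₂
  rw [div_lt_iff₀ hx] at h₃
  exact ⟨_, h₁, lt_of_le_of_ne h₂ (hne _ h₁), by linarith⟩

theorem exists_next (hα : Irrational α) (s : ConvergentPair α) :
    ∃ (t : ConvergentPair α) (n : ℕ), 0 < n ∧ t.k = s.q ∧ t.l = s.p ∧ t.q = s.k + n * s.q ∧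
      t.p = s.l + n * s.p := by
  obtain ⟨k, q, l, p, hq, hlt, halt⟩ := s
  have hirr : ∀ n : ℕ, 0 < n → ((k + n * q : ℕ) : ℝ) * α ≠ ((l + n * p : ℤ) : ℝ) := by
    intro n hn
    exact (hα.natCast_mul (by positivity)).ne_int _
  push_cast at hirr
  rw [abs_lt] at hlt
  rcases halt with ⟨h₁, h₂, h₃⟩ | ⟨h₁, h₂, h₃⟩
  · obtain ⟨n, hn, hn₁, hn₂⟩ := exists_pos_nat_mul_lt (sub_pos.2 h₁) h₂
      (fun n hn heq => hirr n hn (by linarith))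
    refine ⟨⟨q, k + n * q, p, l + n * p, by positivity, ?_, Or.inr ⟨?_, ?_, ?_⟩⟩, n, hn, rfl, rfl,
      rfl, rfl⟩
    · push_cast; rw [abs_lt]; constructor <;> linarith
    · push_cast; linarith
    · push_cast; linarith
    · push_cast; linarith
  · obtain ⟨n, hn, hn₁, hn₂⟩ := exists_pos_nat_mul_lt (sub_pos.2 h₁) h₂
      (fun n hn heq => hirr n hn (by linarith))
    refine ⟨⟨q, k + n * q, p, l + n * p, by positivity, ?_, Or.inl ⟨?_, ?_, ?_⟩⟩, n, hn, rfl, rfl,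
      rfl, rfl⟩
    · push_cast; rw [abs_lt]; constructor <;> linarith
    · push_cast; linarith
    · push_cast; linarith
    · push_cast; linarith

end ConvergentPair

theorem exists_convergent_sequence {α : ℝ} (hα : Irrational α) :
    ∃ (s : ℕ → ConvergentPair α) (n : ℕ → ℕ), (∀ i, 0 < n i) ∧ (∀ i, (s (i + 1)).k = (s i).q) ∧
      (∀ i, (s (i + 1)).l = (s i).p) ∧ (∀ i, (s (i + 1)).q = (s i).k + n i * (s i).q) ∧
      ∀ i, (s (i + 1)).p = (s i).l + n i * (s i).p := by
  choose next n hn hk hl hq hp using ConvergentPair.exists_next hα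
  let s : ℕ → ConvergentPair α := fun i => next^[i] (ConvergentPair.initial hα)
  have hs : ∀ i, s (i + 1) = next (s i) := fun i => iterate_succ_apply' next i _
  exact ⟨s, fun i => n (s i), fun i => hn _, fun i => by rw [hs, hk], fun i => by rw [hs, hl],
    fun i => by rw [hs, hq], fun i => by rw [hs, hp]⟩

theorem eq_add_of_recurrence {q r p : ℕ → ℤ} {n : ℕ → ℤ} {i₀ : ℕ}
    (hq : ∀ i, q (i + 2) = q i + n i * q (i + 1)) (hp : ∀ i, p (i + 2) = p i + n i * p (i + 1))
    (hr : ∀ i ≥ i₀, r (i + 2) = r i + n i * r (i + 1)) {A B : ℤ}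
    (h₀ : r i₀ = A * q i₀ + B * p i₀) (h₁ : r (i₀ + 1) = A * q (i₀ + 1) + B * p (i₀ + 1)) (j : ℕ) :
    r (i₀ + j) = A * q (i₀ + j) + B * p (i₀ + j) := by
  induction j using Nat.twoStepInduction with
  | zero => exact h₀
  | one => exact h₁
  | more j ih₁ ih₂ =>
    rw [← add_assoc] at ih₂ ⊢
    rw [hr _ (by omega), hq, hp, ih₁, ih₂]
    ring

/-- If `δ ∉ ℤ + ℤ α`, then infinitely many convergents `p / q` of `α`, followed by `m`
intermediate convergents, satisfy `m ‖q δ‖ ≥ 1 / 4`. -/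
theorem exists_resonant_convergent {α δ : ℝ} (hα : Irrational α)
    (hδ : ∀ A B : ℤ, δ ≠ A + B * α) (n₀ : ℕ) :
    ∃ (q k m : ℕ) (p l : ℤ), n₀ ≤ q ∧ 0 < q ∧ 0 < m ∧
      1 / 4 ≤ m * |q * δ - round (q * δ)| ∧
      ((l * q - k * p = 1 ∧ (p : ℝ) < q * α ∧ ((k + m * q : ℕ) : ℝ) * α < (l + m * p : ℤ)) ∨
       (k * p - l * q = 1 ∧ q * α < p ∧ ((l + m * p : ℤ) : ℝ) < ((k + m * q : ℕ) : ℝ) * α)) := by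
  obtain ⟨s, n, hn, hk, hl, hq, hp⟩ := exists_convergent_sequence hα
  have hgrow : ∀ i, i ≤ (s (i + 1)).q := by
    intro i
    induction i with
    | zero => exact Nat.zero_le _
    | succ i ih =>
      rw [hq (i + 1), hk]
      have h₁ := (s i).q_pos
      have h₂ := Nat.le_mul_of_pos_left (s (i + 1)).q (hn (i + 1))
      omega
  by_contra! hcon
  have hsmall : ∀ i ≥ n₀ + 1, n i * |((s i).q : ℝ) * δ - round ((s i).q * δ)| < 1 / 4 := by
    intro i hi
    obtain ⟨j, rfl⟩ : ∃ j, i = j + 1 := ⟨i - 1, by omega⟩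
    by_contra! hge
    have hc := hcon (s (j + 1)).q (s (j + 1)).k (n (j + 1)) (s (j + 1)).p (s (j + 1)).l
      (by have := hgrow j; omega) (s (j + 1)).q_pos (hn _) hge
    have hnext := (s (j + 1 + 1)).alternate
    rw [hk (j + 1), hl (j + 1), hq (j + 1), hp (j + 1)] at hnext
    rcases (s (j + 1)).alternate with ⟨h₁, h₂, h₃⟩ | ⟨h₁, h₂, h₃⟩
    · have h₄ := hc.1 h₃ h₁
      rcases hnext with ⟨h₅, h₆, -⟩ | ⟨h₅, -, -⟩ <;> linarith
    · have h₄ := hc.2 h₃ h₁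
      rcases hnext with ⟨h₅, -, -⟩ | ⟨h₅, h₆, -⟩ <;> linarith
  set r : ℕ → ℤ := fun i => round (((s i).q : ℝ) * δ) with hr
  have hsmall' : ∀ i ≥ n₀ + 1, |((s i).q : ℝ) * δ - r i| < 1 / 4 := by
    intro i hi
    have h₁ : (1 : ℝ) ≤ n i := by exact_mod_cast hn i
    exact (le_mul_of_one_le_left (abs_nonneg _) h₁).trans_lt (hsmall i hi)
  have hrec : ∀ i ≥ n₀ + 1, r (i + 2) = r i + n (i + 1) * r (i + 1) := by
    intro i hi
    have h₁ := hsmall' i hi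
    have h₂ := hsmall (i + 1) (by omega)
    have h₃ := hsmall' (i + 2) (by omega)
    have h₄ : ((s (i + 2)).q : ℝ) = (s i).q + n (i + 1) * (s (i + 1)).q := by
      have := hq (i + 1)
      rw [hk i] at this
      exact_mod_cast this
    change n (i + 1) * |((s (i + 1)).q : ℝ) * δ - r (i + 1)| < 1 / 4 at h₂
    have h₅ : (n (i + 1) : ℝ) * |((s (i + 1)).q : ℝ) * δ - r (i + 1)| =
        |n (i + 1) * (((s (i + 1)).q : ℝ) * δ - r (i + 1))| := by
      rw [abs_mul, Nat.abs_cast]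
    rw [h₅] at h₂
    rw [h₄] at h₃
    rw [abs_lt] at h₁ h₂ h₃
    have h₆ : ((r (i + 2) - (r i + n (i + 1) * r (i + 1)) : ℤ) : ℝ) < 1 := by
      push_cast; linarith
    have h₇ : (-1 : ℝ) < ((r (i + 2) - (r i + n (i + 1) * r (i + 1)) : ℤ) : ℝ) := by
      push_cast; linarith
    have h₈ : r (i + 2) - (r i + n (i + 1) * r (i + 1)) < 1 := by exact_mod_cast h₆
    have h₉ : -1 < r (i + 2) - (r i + n (i + 1) * r (i + 1)) := by exact_mod_cast h₇
    omega
  set i₀ := n₀ + 1 with hi₀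
  have hAB : ∃ A B : ℤ, r i₀ = A * (s i₀).q + B * (s i₀).p ∧
      r (i₀ + 1) = A * (s (i₀ + 1)).q + B * (s (i₀ + 1)).p := by
    have hdet := (s (i₀ + 1)).alternate
    rw [hk i₀, hl i₀] at hdet
    rcases hdet with ⟨-, -, h₁⟩ | ⟨-, -, h₁⟩
    · refine ⟨r (i₀ + 1) * (s i₀).p - r i₀ * (s (i₀ + 1)).p,
        r i₀ * (s (i₀ + 1)).q - r (i₀ + 1) * (s i₀).q, ?_, ?_⟩
      · linear_combination (-r i₀) * h₁
      · linear_combination (-r (i₀ + 1)) * h₁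
    · refine ⟨-(r (i₀ + 1) * (s i₀).p - r i₀ * (s (i₀ + 1)).p),
        -(r i₀ * (s (i₀ + 1)).q - r (i₀ + 1) * (s i₀).q), ?_, ?_⟩
      · linear_combination (-r i₀) * h₁
      · linear_combination (-r (i₀ + 1)) * h₁
  obtain ⟨A, B, hA₀, hA₁⟩ := hAB
  have hall := eq_add_of_recurrence (q := fun i => ((s i).q : ℤ)) (p := fun i => (s i).p) (r := r)
    (n := fun i => (n (i + 1) : ℤ)) (i₀ := i₀)
    (fun i => by have := hq (i + 1); rw [hk i] at this; exact_mod_cast this)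
    (fun i => by have := hp (i + 1); rw [hl i] at this; exact_mod_cast this) hrec hA₀ hA₁
  have hbound : ∀ j : ℕ, (j : ℝ) * |δ - A - B * α| ≤ 1 / 4 + |(B : ℝ)| := by
    intro j
    have h₁ := hsmall' (i₀ + (j + 1)) (by omega)
    rw [hall (j + 1)] at h₁
    push_cast at h₁
    have h₂ := (s (i₀ + (j + 1))).abs_lt_one
    have h₃ : (j : ℝ) ≤ (s (i₀ + (j + 1))).q := by
      have this : i₀ + j ≤ (s (i₀ + (j + 1))).q := hgrow (i₀ + j)
      exact_mod_cast (Nat.le_add_left j i₀).trans this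
    generalize (s (i₀ + (j + 1))).q = Q at *
    generalize (s (i₀ + (j + 1))).p = P at *
    have h₄ : |B * (Q * α - P)| ≤ |(B : ℝ)| := by
      rw [abs_mul]; exact mul_le_of_le_one_right (abs_nonneg _) h₂.le
    calc (j : ℝ) * |δ - A - B * α| ≤ Q * |δ - A - B * α| := by gcongr
      _ = |(Q * δ - (A * Q + B * P)) - B * (Q * α - P)| := by
        rw [← Nat.abs_cast Q, ← abs_mul, Nat.abs_cast]; ring_nf
      _ ≤ |Q * δ - (A * Q + B * P)| + |B * (Q * α - P)| := abs_sub _ _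
      _ ≤ 1 / 4 + |(B : ℝ)| := add_le_add h₁.le h₄
  refine hδ A B ?_
  by_contra hne
  have hpos : 0 < |δ - A - B * α| := abs_pos.2 fun h0 => hne (by linarith)
  obtain ⟨j, hj⟩ := exists_nat_gt ((1 / 4 + |(B : ℝ)|) / |δ - A - B * α|)
  rw [div_lt_iff₀ hpos] at hj
  linarith [hbound j]

/-- The mean displacement of the orbit of `0`; for lifts of circle homeomorphisms this is the
translation number. -/
noncomputable def rotNum (F : ℝ → ℝ) : ℝ :=
  limsup (fun n : ℕ => F^[n] 0 / n) atTop

namespace IsTwoBreak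

variable {a b σ₁ σ₂ : ℝ} {F : ℝ → ℝ}

/-- A two-break map as a bundled monotone degree one lift. -/
def toLift (h : IsTwoBreak a b σ₁ σ₂ F) : CircleDeg1Lift :=
  ⟨⟨F, h.strictMono.monotone⟩, h.map_add_one⟩

theorem coe_toLift (h : IsTwoBreak a b σ₁ σ₂ F) : ⇑h.toLift = F := rfl

theorem toLift_pow_apply (h : IsTwoBreak a b σ₁ σ₂ F) (n : ℕ) (x : ℝ) :
    (h.toLift ^ n) x = F^[n] x := by
  rw [CircleDeg1Lift.coe_pow, coe_toLift]

theorem rotNum_eq (h : IsTwoBreak a b σ₁ σ₂ F) :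
    rotNum F = h.toLift.translationNumber := by
  have := h.toLift.tendsto_translation_number₀
  simp only [toLift_pow_apply] at this
  exact this.limsup_eq

theorem pow_translationNumber (h : IsTwoBreak a b σ₁ σ₂ F) (q : ℕ) :
    (h.toLift ^ q).translationNumber = q * rotNum F := by
  rw [CircleDeg1Lift.translationNumber_pow, h.rotNum_eq]

theorem lt_iterate_of_lt_rotNum (h : IsTwoBreak a b σ₁ σ₂ F) {q : ℕ} {p : ℤ}
    (hp : (p : ℝ) < q * rotNum F) (x : ℝ) : x + p < F^[q] x := by
  rw [← h.pow_translationNumber] at hp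
  simpa only [toLift_pow_apply] using
    (h.toLift ^ q).lt_map_of_int_lt_translationNumber hp x

theorem iterate_lt_of_rotNum_lt (h : IsTwoBreak a b σ₁ σ₂ F) {q : ℕ} {p : ℤ}
    (hp : q * rotNum F < p) (x : ℝ) : F^[q] x < x + p := by
  rw [← h.pow_translationNumber] at hp
  simpa only [toLift_pow_apply] using
    (h.toLift ^ q).map_lt_of_translationNumber_lt_int hp x

theorem not_irrational_rotNum (h : IsTwoBreak a b σ₁ σ₂ F) {q : ℕ} {p : ℤ} (hq : 0 < q) {x : ℝ}
    (hx : F^[q] x = x + p) : ¬ Irrational (rotNum F) := by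
  rw [h.rotNum_eq, CircleDeg1Lift.translationNumber_of_map_pow_eq_add_int (x := x) (n := q)
    (m := p) _ (by rw [toLift_pow_apply, hx]) hq]
  exact fun hi => hi ⟨(p / q : ℚ), by push_cast; rfl⟩

theorem exists_iterate_eq (h : IsTwoBreak a b σ₁ σ₂ F) (hr : ¬ Irrational (rotNum F)) :
    ∃ q : ℕ, 0 < q ∧ ∃ (p : ℤ) (x : ℝ), F^[q] x = x + p := by
  rw [Irrational, not_not] at hr
  obtain ⟨r, hr⟩ := hr
  refine ⟨r.den, r.den_pos, r.num, ?_⟩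
  have := (h.toLift.translationNumber_eq_rat_iff (m := r.num) h.continuous r.den_pos).1
    (by rw [← h.rotNum_eq, ← hr]; exact_mod_cast (Rat.num_div_den r).symm)
  simpa only [toLift_pow_apply] using this

theorem iterate_add_le_iterate_add_const (h : IsTwoBreak a b σ₁ σ₂ F) {η : ℝ} (hη : 0 ≤ η) {q : ℕ}
    (hq : 0 < q) (x : ℝ) : F^[q] x + η ≤ (fun y => F y + η)^[q] x := by
  obtain ⟨n, rfl⟩ := Nat.exists_eq_succ_of_ne_zero hq.ne'
  rw [iterate_succ_apply', iterate_succ_apply']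
  gcongr
  apply h.strictMono.monotone
  exact h.strictMono.monotone.iterate_le_of_le (fun y => by simpa using hη) n x

/-- An irrational rotation number determines the translation parameter of a vertical family. -/
theorem rotNum_add_const_ne (h : IsTwoBreak a b σ₁ σ₂ F) (hi : Irrational (rotNum F)) {η : ℝ}
    (hη : 0 < η) : rotNum (fun x => F x + η) ≠ rotNum F := by
  intro heq
  set α := rotNum F with hα
  have h' := h.add_const η
  obtain ⟨n, hn⟩ := exists_nat_one_div_lt hη
  obtain ⟨q, hq, -, hle⟩ := Real.exists_nat_abs_mul_sub_round_le α (Nat.succ_pos n)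
  set p := round (q * α) with hp
  have hlt : |q * α - p| < η := by
    refine hle.trans_lt (lt_of_le_of_lt ?_ hn)
    apply one_div_le_one_div_of_le (by positivity)
    push_cast
    linarith
  rw [abs_lt] at hlt
  rcases lt_trichotomy ((q : ℝ) * α) p with hc | hc | hc
  · obtain ⟨x, hx⟩ : ∃ x, x + (p - η) < F^[q] x := by
      by_contra! hcon
      have := (h.toLift ^ q).translationNumber_le_of_le_add (z := p - η)
        (fun x => by rw [toLift_pow_apply]; exact hcon x)
      rw [pow_translationNumber] at this
      linarith
    have h₁ := h.iterate_add_le_iterate_add_const hη.le hq x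
    have h₂ := h'.iterate_lt_of_rotNum_lt (q := q) (p := p) (by rwa [heq]) x
    linarith
  · exact (hi.natCast_mul hq.ne').ne_int p hc
  · obtain ⟨x, hx⟩ : ∃ x, (fun y => F y + η)^[q] x < x + (p + η) := by
      by_contra! hcon
      have := (h'.toLift ^ q).le_translationNumber_of_add_le (z := p + η)
        (fun x => by rw [toLift_pow_apply]; exact hcon x)
      rw [pow_translationNumber, heq] at this
      linarith
    have h₁ := h.iterate_add_le_iterate_add_const hη.le hq x
    have h₂ := h.lt_iterate_of_lt_rotNum (q := q) (p := p) hc x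
    linarith

theorem subsingleton_rotNum_eq (h : IsTwoBreak a b σ₁ σ₂ F) {α : ℝ} (hα : Irrational α) :
    {t : ℝ | rotNum (fun x => F x + t) = α}.Subsingleton := by
  have key : ∀ s t : ℝ, s < t → rotNum (fun x => F x + s) = α → rotNum (fun x => F x + t) ≠ α := by
    intro s t hst hs ht
    refine (h.add_const s).rotNum_add_const_ne (hs ▸ hα) (sub_pos.2 hst) ?_
    simpa [hs, add_assoc] using ht
  intro s hs t ht
  rcases lt_trichotomy s t with hst | hst | hst
  · exact (key s t hst hs ht).elim
  · exact hst
  · exact (key t s hst ht hs).elim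

end IsTwoBreak

/-- A set of reals which is uniformly porous at each of its points is null. -/
theorem volume_eq_zero_of_porous {S : Set ℝ} (K : ℝ)
    (hS : ∀ t ∈ S, ∀ ε > 0, ∃ v, ∃ ρ : ℝ, 0 < ρ ∧ ρ < ε ∧ |t - v| ≤ K * ρ ∧
      Disjoint S (Metric.closedBall v ρ)) : volume S = 0 := by
  have hae := IsUnifLocDoublingMeasure.ae_tendsto_measure_inter_div (volume : Measure ℝ) S K
  rw [ae_iff] at hae
  rw [Measure.restrict_apply_superset] at hae
  · exact hae
  · intro t ht hcon
    choose v ρ hρ hρε hv hdisj using fun n : ℕ => hS t ht (1 / ((n : ℝ) + 1)) (by positivity)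
    have hlim : Tendsto ρ atTop (𝓝[>] 0) := by
      refine tendsto_nhdsWithin_iff.2 ⟨?_, Eventually.of_forall hρ⟩
      exact squeeze_zero (fun n => (hρ n).le) (fun n => (hρε n).le)
        tendsto_one_div_add_atTop_nhds_zero_nat
    have := hcon v ρ hlim (Eventually.of_forall fun n => by
      rw [Metric.mem_closedBall, Real.dist_eq]; exact hv n)
    simp only [(hdisj _).inter_eq, measure_empty, ENNReal.zero_div] at this
    exact zero_ne_one (tendsto_nhds_unique tendsto_const_nhds this)

theorem iterate_conj_neg (F : ℝ → ℝ) (n : ℕ) (x : ℝ) :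
    (fun y => -F (-y))^[n] x = -F^[n] (-x) := by
  induction n with
  | zero => simp
  | succ n ih => rw [iterate_succ_apply', ih, iterate_succ_apply', neg_neg]

namespace IsTwoBreak

variable {a b σ₁ σ₂ : ℝ} {F : ℝ → ℝ}

/-- The version of `exists_locked_interval` for convergents lying above the rotation number. -/
theorem exists_locked_interval_of_above (h : IsTwoBreak a b σ₁ σ₂ F) {q k m : ℕ} {p l : ℤ}
    (hq : 0 < q) (hm : 0 < m) (hdet : k * p - l * q = 1) (hup : ∀ x, F^[q] x < x + p)
    (hlow : ∀ x, x + (l + m * p) < F^[k + m * q] x) {e : ℝ} (he : 0 ≤ e) (he1 : e ≤ 1)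
    (hres : ∀ N : ℤ, e ≤ |(Real.log σ₁ - Real.log σ₂) * N + q * Real.log σ₂|) :
    ∃ R > 0, R ≤ Real.exp (2 * |Real.log σ₁ - Real.log σ₂|) / q ∧ ∃ r, 0 ≤ r ∧ r ≤ R ∧
      ∀ τ ∈ Icc r (r + m * e * R / (6 * Real.exp (2 * |Real.log σ₁ - Real.log σ₂|) ^ 2)),
        ∃ x, (fun x => F x + τ)^[q] x = x + p := by
  obtain ⟨R, hR, hRq, r, hr, hrR, hloc⟩ := h.conj_neg.exists_locked_interval (q := q) (p := -p)
    (k := k) (m := m) (l := -l) hq hm (by linarith)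
    (fun x => by rw [iterate_conj_neg]; push_cast; linarith [hup (-x)])
    (fun x => by rw [iterate_conj_neg]; push_cast; linarith [hlow (-x)]) he he1 hres
  refine ⟨R, hR, hRq, r, hr, hrR, fun τ hτ => ?_⟩
  obtain ⟨x, hx⟩ := hloc τ hτ
  refine ⟨-x, ?_⟩
  have : (fun y => -F (-y) - τ) = fun y => -((fun z => F z + τ) (-y)) := by
    funext y; ring
  rw [this, iterate_conj_neg fun z => F z + τ] at hx
  push_cast at hx
  linarith

theorem log_ratio_mem_Ioo (h : IsTwoBreak a b σ₁ σ₂ F) (hne : σ₁ ≠ σ₂) :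
    -Real.log σ₂ / (Real.log σ₁ - Real.log σ₂) ∈ Ioo (0 : ℝ) 1 := by
  have hrel := h.slope_relation
  have h₁ := h.lt
  have h₂ := h.lt_add_one
  have hp₁ := h.pos₁
  have hp₂ := h.pos₂
  rcases hne.lt_or_gt with hlt | hlt
  · have hσ₁ : σ₁ < 1 := by nlinarith
    have hσ₂ : 1 < σ₂ := by nlinarith
    have l₁ := Real.log_neg hp₁ hσ₁
    have l₂ := Real.log_pos hσ₂
    refine ⟨div_pos_of_neg_of_neg (by linarith) (by linarith), ?_⟩
    rw [div_lt_one_of_neg (by linarith)]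
    linarith
  · have hσ₁ : 1 < σ₁ := by nlinarith
    have hσ₂ : σ₂ < 1 := by nlinarith
    have l₁ := Real.log_pos hσ₁
    have l₂ := Real.log_neg hp₂ hσ₂
    refine ⟨div_pos (by linarith) (by linarith), ?_⟩
    rw [div_lt_one (by linarith)]
    linarith

/-- Parameters at which the logarithmic slope ratio lies in `ℤ + ℤα`, `α` being the rotation
number, are countable in a vertical family. -/
theorem countable_resonant (h : IsTwoBreak a b σ₁ σ₂ F) {δ : ℝ} (hδ : δ ∈ Ioo (0 : ℝ) 1) :
    {t : ℝ | Irrational (rotNum fun x => F x + t) ∧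
      ∃ A B : ℤ, δ = A + B * rotNum fun x => F x + t}.Countable := by
  have : {t : ℝ | Irrational (rotNum fun x => F x + t) ∧
      ∃ A B : ℤ, δ = A + B * rotNum fun x => F x + t} = ⋃ A : ℤ, ⋃ B : ℤ,
      {t : ℝ | Irrational (rotNum fun x => F x + t) ∧
        δ = A + B * rotNum fun x => F x + t} := by
    ext t
    simp
  rw [this]
  refine countable_iUnion fun A => countable_iUnion fun B => Subsingleton.countable ?_
  intro s hs t ht
  have hB : (B : ℝ) ≠ 0 := by
    intro hB
    have hA : δ = A := by simpa [hB] using hs.2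
    have h₀ := hδ.1
    have h₁ := hδ.2
    rw [hA] at h₀ h₁
    norm_cast at h₀ h₁
    omega
  refine h.subsingleton_rotNum_eq hs.1 rfl ?_
  exact mul_left_cancel₀ hB (by linarith [hs.2, ht.2])

theorem volume_nonresonant_eq_zero (h : IsTwoBreak a b σ₁ σ₂ F) (hne : σ₁ ≠ σ₂) :
    volume {t : ℝ | Irrational (rotNum fun x => F x + t) ∧
      ∀ A B : ℤ, -Real.log σ₂ / (Real.log σ₁ - Real.log σ₂) ≠
        A + B * rotNum fun x => F x + t} = 0 := by
  have hs : Real.log σ₁ - Real.log σ₂ ≠ 0 :=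
    sub_ne_zero.2 fun hlog => hne (Real.log_injOn_pos h.pos₁ h.pos₂ hlog)
  set s := Real.log σ₁ - Real.log σ₂ with hsdef
  set δ := -Real.log σ₂ / s with hδdef
  set E := Real.exp (2 * |s|) with hE
  have hE0 : 0 < E := Real.exp_pos _
  set c := min 1 |s| / 4 with hc
  have hc0 : 0 < c := by have := abs_pos.2 hs; positivity
  have hlog : Real.log σ₂ = -(s * δ) := by rw [hδdef]; field_simp
  apply volume_eq_zero_of_porous (12 * E ^ 2 / c + 1)
  rintro t ⟨hirr, hδ⟩ ε hε
  obtain ⟨n₀, hn₀⟩ := exists_nat_gt (c * E / (12 * E ^ 2) / ε)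
  obtain ⟨q, k, m, p, l, hqn, hq, hm, hmδ, hcase⟩ := exists_resonant_convergent hirr hδ n₀
  set d := |q * δ - round (q * δ)| with hd
  have hd0 : 0 ≤ d := abs_nonneg _
  have hd1 : d ≤ 1 := (abs_sub_round _).trans (by norm_num)
  set e := min 1 |s| * d with he
  have hmin : 0 ≤ min 1 |s| := by positivity
  have he0 : 0 ≤ e := by positivity
  have he1 : e ≤ 1 := mul_le_one₀ (min_le_left _ _) hd0 hd1
  have hce : c ≤ m * e := by
    calc c = min 1 |s| * (1 / 4) := by rw [hc]; ring
      _ ≤ min 1 |s| * (m * d) := by gcongr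
      _ = m * e := by rw [he]; ring
  have hres : ∀ N : ℤ, e ≤ |s * N + q * Real.log σ₂| := by
    intro N
    calc e ≤ |s| * |q * δ - N| :=
          mul_le_mul (min_le_right _ _) (round_le _ _) hd0 (abs_nonneg _)
      _ = |s * N + q * Real.log σ₂| := by
          rw [← abs_mul, ← abs_neg, hlog]; ring_nf
  have hft := h.add_const t
  obtain ⟨κ, hκ, R, hR, hRq, r, hr, hrR, hloc⟩ : ∃ κ : ℝ, |κ| = 1 ∧
      ∃ R > 0, R ≤ E / q ∧ ∃ r, 0 ≤ r ∧ r ≤ R ∧ ∀ τ ∈ Icc r (r + m * e * R / (6 * E ^ 2)),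
        ∃ x, (fun x => F x + (t + κ * τ))^[q] x = x + p := by
    rcases hcase with ⟨hdet, hp, hl⟩ | ⟨hdet, hp, hl⟩
    · refine ⟨-1, by simp, ?_⟩
      obtain ⟨R, hR, hRq, r, hr, hrR, hloc⟩ := hft.exists_locked_interval hq hm hdet
        (hft.lt_iterate_of_lt_rotNum hp)
        (fun x => by exact_mod_cast hft.iterate_lt_of_rotNum_lt hl x) he0 he1 hres
      refine ⟨R, hR, hRq, r, hr, hrR, fun τ hτ => ?_⟩
      obtain ⟨x, hx⟩ := hloc τ hτ
      refine ⟨x, ?_⟩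
      rw [← hx]
      congr 2
      funext y
      ring
    · refine ⟨1, by simp, ?_⟩
      obtain ⟨R, hR, hRq, r, hr, hrR, hloc⟩ := hft.exists_locked_interval_of_above hq hm hdet
        (hft.iterate_lt_of_rotNum_lt hp)
        (fun x => by exact_mod_cast hft.lt_iterate_of_lt_rotNum hl x) he0 he1 hres
      refine ⟨R, hR, hRq, r, hr, hrR, fun τ hτ => ?_⟩
      obtain ⟨x, hx⟩ := hloc τ hτ
      refine ⟨x, ?_⟩
      rw [← hx]
      congr 2
      funext y
      ring
  set ρ := c * R / (12 * E ^ 2) with hρ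
  have hρ0 : 0 < ρ := by positivity
  have hκκ : κ * κ = 1 := by rw [← abs_mul_abs_self, hκ, one_mul]
  refine ⟨t + κ * (r + ρ), ρ, hρ0, ?_, ?_, ?_⟩
  · have hq' : (0 : ℝ) < q := Nat.cast_pos.2 hq
    have hn₀q : (n₀ : ℝ) ≤ q := by exact_mod_cast hqn
    calc ρ ≤ c * (E / q) / (12 * E ^ 2) := by rw [hρ]; gcongr
      _ = c * E / (12 * E ^ 2) / q := by field_simp
      _ < ε := by
          rw [div_lt_comm₀ hq' hε]
          exact hn₀.trans_le hn₀q
  · have : t - (t + κ * (r + ρ)) = -(κ * (r + ρ)) := by ring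
    rw [this, abs_neg, abs_mul, hκ, one_mul, abs_of_nonneg (by positivity), add_mul, one_mul]
    gcongr
    refine hrR.trans (le_of_eq ?_)
    rw [hρ]
    field_simp
  · rw [Set.disjoint_left]
    rintro u ⟨hu, -⟩ hball
    rw [Metric.mem_closedBall, Real.dist_eq] at hball
    set τ := κ * (u - t) with hτ
    have hut : u = t + κ * τ := by rw [hτ, ← mul_assoc, hκκ]; ring
    have hball' : |τ - (r + ρ)| ≤ ρ := by
      rw [hut, add_sub_add_left_eq_sub, ← mul_sub, abs_mul, hκ, one_mul] at hball
      exact hball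
    rw [abs_le] at hball'
    have h2ρ : 2 * ρ ≤ m * e * R / (6 * E ^ 2) := by
      calc 2 * ρ = c * R / (6 * E ^ 2) := by rw [hρ]; field_simp; norm_num
        _ ≤ m * e * R / (6 * E ^ 2) := by gcongr
    obtain ⟨x, hx⟩ := hloc τ ⟨by linarith, by linarith⟩
    rw [← hut] at hx
    exact (h.add_const u).not_irrational_rotNum hq hx hu

/-- In a vertical family of maps with two genuine breaks, the rotation number is almost surely
rational. -/
theorem volume_irrational_rotNum_eq_zero (h : IsTwoBreak a b σ₁ σ₂ F) (hne : σ₁ ≠ σ₂) :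
    volume {t : ℝ | Irrational (rotNum fun x => F x + t)} = 0 := by
  refine measure_mono_null ?_ (measure_union_null (h.volume_nonresonant_eq_zero hne)
    ((h.countable_resonant (h.log_ratio_mem_Ioo hne)).measure_zero volume))
  intro t ht
  by_cases hA : ∃ A B : ℤ, -Real.log σ₂ / (Real.log σ₁ - Real.log σ₂) =
      A + B * rotNum fun x => F x + t
  · exact Or.inr ⟨ht, hA⟩
  · push Not at hA
    exact Or.inl ⟨ht, hA⟩

end IsTwoBreak

section Minimality

variable {F : ℝ → ℝ} {f : Circle1 → Circle1}

theorem Induces.iterate_coe (hf : Induces F f) (n : ℕ) (x : ℝ) :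
    f^[n] (x : Circle1) = ((F^[n] x : ℝ) : Circle1) := by
  induction n with
  | zero => rfl
  | succ n ih => rw [iterate_succ_apply', ih, hf, iterate_succ_apply']

theorem not_minimal_of_isPeriodicPt (hinj : Injective f) {q : ℕ} (hq : 0 < q) {z : Circle1}
    (hz : IsPeriodicPt f q z) : ¬ MinimalCircleMap f := by
  intro hmin
  have hsub : {y : Circle1 | ∃ n : ℕ, f^[n] z = y ∨ f^[n] y = z} ⊆
      (fun i => f^[i] z) '' Set.Iio q := by
    have hmem : ∀ n, f^[n] z ∈ (fun i => f^[i] z) '' Set.Iio q := fun n =>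
      ⟨n % q, Nat.mod_lt n hq, hz.iterate_mod_apply n⟩
    rintro y ⟨n, hn | hn⟩
    · exact hn ▸ hmem n
    · have : f^[n] y = f^[n] (f^[n * q - n] z) := by
        rw [← iterate_add_apply, Nat.add_sub_cancel' (Nat.le_mul_of_pos_right n hq), hn]
        exact (hz.const_mul n).symm
      exact hinj.iterate n this ▸ hmem _
  have hfin := (Set.finite_Iio q).image fun i => f^[i] z
  have huniv : (fun i => f^[i] z) '' Set.Iio q = univ := by
    rw [← hfin.isClosed.closure_eq]
    exact ((hmin z).mono hsub).closure_eq
  have : Infinite (Set.Ico (0 : ℝ) (0 + 1)) := (Set.Ico_infinite (by norm_num)).to_subtype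
  have : Infinite Circle1 := Infinite.of_injective _ (AddCircle.equivIco (1 : ℝ) 0).symm.injective
  exact Set.infinite_univ (huniv ▸ hfin)

end Minimality

namespace IsTwoBreak

variable {a b σ₁ σ₂ : ℝ} {F G : ℝ → ℝ}

theorem injective_of_induces (h : IsTwoBreak a b σ₁ σ₂ F) {f : Circle1 → Circle1}
    (hf : Induces F f) : Injective f := by
  intro y z
  induction y using QuotientAddGroup.induction_on with | H y => ?_
  induction z using QuotientAddGroup.induction_on with | H z => ?_
  intro hyz
  have hyz' : ((F y : ℝ) : Circle1) = ((F z : ℝ) : Circle1) := by rw [← hf, ← hf]; exact hyz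
  rw [← sub_eq_zero, ← AddCircle.coe_sub, AddCircle.coe_eq_zero_iff] at hyz'
  obtain ⟨n, hn⟩ := hyz'
  have hF : F y = F (z + n) := by
    rw [h.map_add_int]
    simp only [zsmul_eq_mul, mul_one] at hn
    linarith
  rw [h.strictMono.injective hF]
  simp

theorem irrational_rotNum_of_minimal (h : IsTwoBreak a b σ₁ σ₂ F) {f : Circle1 → Circle1}
    (hf : Induces F f) (hmin : MinimalCircleMap f) : Irrational (rotNum F) := by
  by_contra hr
  obtain ⟨q, hq, p, x, hx⟩ := h.exists_iterate_eq hr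
  refine not_minimal_of_isPeriodicPt (h.injective_of_induces hf) hq (z := (x : Circle1)) ?_ hmin
  rw [IsPeriodicPt, IsFixedPt, hf.iterate_coe, hx]
  simp

theorem eq_of_eq_left (h : IsTwoBreak a b σ₁ σ₂ F) (h' : IsTwoBreak a b σ₁ σ₂ G)
    (heq : F a = G a) : F = G := by
  have hb : F b = G b := by
    rw [h.eq_left b ⟨h.lt.le, le_rfl⟩, h'.eq_left b ⟨h.lt.le, le_rfl⟩, heq]
  funext x
  have hx : x = (x - ⌊x - a⌋) + (⌊x - a⌋ : ℤ) := by ring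
  rw [hx, h.map_add_int, h'.map_add_int]
  congr 1
  have h₀ := Int.floor_le (x - a)
  have h₁ := Int.lt_floor_add_one (x - a)
  rcases le_total (x - ⌊x - a⌋) b with hle | hle
  · rw [h.eq_left _ ⟨by linarith, hle⟩, h'.eq_left _ ⟨by linarith, hle⟩, heq]
  · rw [h.eq_right _ ⟨hle, by linarith⟩, h'.eq_right _ ⟨hle, by linarith⟩, hb]

end IsTwoBreak

/-- The piecewise affine lift with break points `x₁, x₂` and images `y₁, y₂`, by a formula. -/
noncomputable def twoBreakMap (x₁ x₂ y₁ y₂ x : ℝ) : ℝ :=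
  y₁ + (x - x₁) + ((y₂ - y₁) / (x₂ - x₁) - (1 - (y₂ - y₁)) / (1 - (x₂ - x₁))) *
    (min (Int.fract (x - x₁)) (x₂ - x₁) - (x₂ - x₁) * Int.fract (x - x₁))

section TwoBreakMap

variable {x₁ x₂ y₁ y₂ : ℝ}

theorem twoBreakMap_eq_of_mem_Icc (hx : x₁ < x₂) (hx' : x₂ < x₁ + 1) {x : ℝ}
    (hxm : x ∈ Icc x₁ (x₁ + 1)) :
    twoBreakMap x₁ x₂ y₁ y₂ x =
      y₁ + (x - x₁) + ((y₂ - y₁) / (x₂ - x₁) - (1 - (y₂ - y₁)) / (1 - (x₂ - x₁))) *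
        (min (x - x₁) (x₂ - x₁) - (x₂ - x₁) * (x - x₁)) := by
  rw [twoBreakMap]
  rcases hxm.2.lt_or_eq with hlt | rfl
  · rw [Int.fract_eq_self.2 ⟨by linarith [hxm.1], by linarith⟩]
  · rw [add_sub_cancel_left, Int.fract_one, min_eq_left (by linarith), min_eq_right (by linarith)]
    ring

theorem continuous_twoBreakMap (hx : x₁ < x₂) (hx' : x₂ < x₁ + 1) :
    Continuous (twoBreakMap x₁ x₂ y₁ y₂) := by
  have hg : Continuous ((fun u : ℝ => min u (x₂ - x₁) - (x₂ - x₁) * u) ∘ Int.fract) := by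
    refine ContinuousOn.comp_fract'' (Continuous.continuousOn (by fun_prop)) ?_
    rw [min_eq_left (by linarith), min_eq_right (by linarith)]
    ring
  have hg' : Continuous fun x : ℝ => min (Int.fract (x - x₁)) (x₂ - x₁) -
    (x₂ - x₁) * Int.fract (x - x₁) := hg.comp (continuous_id.sub continuous_const)
  unfold twoBreakMap
  fun_prop

theorem isTwoBreak_twoBreakMap (hx : x₁ < x₂) (hx' : x₂ < x₁ + 1) (hy : y₁ < y₂)
    (hy' : y₂ < y₁ + 1) :
    IsTwoBreak x₁ x₂ ((y₂ - y₁) / (x₂ - x₁)) ((1 - (y₂ - y₁)) / (1 - (x₂ - x₁)))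
      (twoBreakMap x₁ x₂ y₁ y₂) := by
  have hℓ : 0 < x₂ - x₁ := by linarith
  have hℓ' : 0 < 1 - (x₂ - x₁) := by linarith
  refine ⟨continuous_twoBreakMap hx hx', fun x => ?_, hx, hx', div_pos (by linarith) hℓ,
    div_pos (by linarith) hℓ', fun x hxm => ?_, fun x hxm => ?_⟩
  · rw [twoBreakMap, twoBreakMap, show x + 1 - x₁ = x - x₁ + 1 by ring, Int.fract_add_one]
    ring
  · rw [twoBreakMap_eq_of_mem_Icc hx hx' ⟨hxm.1, by linarith [hxm.2]⟩,
      twoBreakMap_eq_of_mem_Icc hx hx' ⟨le_rfl, by linarith⟩,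
      min_eq_left (by linarith [hxm.2]), min_eq_left (by linarith)]
    field_simp
    ring
  · rw [twoBreakMap_eq_of_mem_Icc hx hx' ⟨by linarith [hxm.1], hxm.2⟩,
      twoBreakMap_eq_of_mem_Icc hx hx' ⟨hx.le, hx'.le⟩,
      min_eq_right (by linarith [hxm.1]), min_eq_left le_rfl]
    field_simp
    ring

theorem twoBreakMap_left (hx : x₁ < x₂) (hx' : x₂ < x₁ + 1) :
    twoBreakMap x₁ x₂ y₁ y₂ x₁ = y₁ := by
  rw [twoBreakMap_eq_of_mem_Icc hx hx' ⟨le_rfl, by linarith⟩, sub_self, min_eq_left (by linarith)]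
  ring

theorem IsPiecewiseAffineTwoBreakLift.isTwoBreak {F : ℝ → ℝ}
    (h : IsPiecewiseAffineTwoBreakLift x₁ x₂ y₁ y₂ F) (hx : x₁ < x₂) (hx' : x₂ < x₁ + 1)
    (hy : y₁ < y₂) (hy' : y₂ < y₁ + 1) :
    IsTwoBreak x₁ x₂ ((y₂ - y₁) / (x₂ - x₁)) ((1 - (y₂ - y₁)) / (1 - (x₂ - x₁))) F := by
  obtain ⟨⟨hcont, -, hadd⟩, h₁, h₂, ⟨c, d, hcd⟩, ⟨c', d', hcd'⟩⟩ := h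
  have hℓ : 0 < x₂ - x₁ := by linarith
  have hℓ' : 0 < 1 - (x₂ - x₁) := by linarith
  have e₁ := hcd x₁ ⟨le_rfl, hx.le⟩
  have e₂ := hcd x₂ ⟨hx.le, le_rfl⟩
  have e₃ := hcd' x₂ ⟨le_rfl, hx'.le⟩
  have e₄ := hcd' (x₁ + 1) ⟨hx'.le, le_rfl⟩
  rw [hadd] at e₄
  have hc : (y₂ - y₁) / (x₂ - x₁) = c := by
    rw [div_eq_iff hℓ.ne']; linarith
  have hc' : (1 - (y₂ - y₁)) / (1 - (x₂ - x₁)) = c' := by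
    rw [div_eq_iff hℓ'.ne']; linarith
  refine ⟨hcont, hadd, hx, hx', div_pos (by linarith) hℓ, div_pos (by linarith) hℓ',
    fun x hxm => ?_, fun x hxm => ?_⟩
  · rw [hc, hcd x hxm, e₁]; ring
  · rw [hc', hcd' x hxm, e₃]; ring

theorem IsPiecewiseAffineTwoBreakLift.eq_twoBreakMap {F : ℝ → ℝ}
    (h : IsPiecewiseAffineTwoBreakLift x₁ x₂ y₁ y₂ F) (hx : x₁ < x₂) (hx' : x₂ < x₁ + 1)
    (hy : y₁ < y₂) (hy' : y₂ < y₁ + 1) : F = twoBreakMap x₁ x₂ y₁ y₂ :=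
  (h.isTwoBreak hx hx' hy hy').eq_of_eq_left (isTwoBreak_twoBreakMap hx hx' hy hy')
    (by rw [h.2.1, twoBreakMap_left hx hx'])

theorem twoBreakMap_add_const (x₁ x₂ y₁ y₂ t : ℝ) :
    twoBreakMap x₁ x₂ (y₁ + t) (y₂ + t) = fun x => twoBreakMap x₁ x₂ y₁ y₂ x + t := by
  funext x
  rw [twoBreakMap, twoBreakMap, add_sub_add_right_eq_sub]
  ring

end TwoBreakMap

theorem measurable_rotNum_twoBreakMap :
    Measurable fun P : ℝ × ℝ × ℝ × ℝ => rotNum (twoBreakMap P.1 P.2.1 P.2.2.1 P.2.2.2) := by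
  refine Measurable.limsup fun n => Measurable.div_const ?_ _
  induction n with
  | zero => exact measurable_const
  | succ n ih =>
    simp only [iterate_succ_apply']
    simp only [twoBreakMap] at ih ⊢
    have hfract := (ih.sub measurable_fst).fract
    fun_prop

/-- Parameters of genuinely broken maps with irrational rotation number. -/
def irrationalParameters : Set (ℝ × ℝ × ℝ × ℝ) :=
  {P | (P.1 < P.2.1 ∧ P.2.1 < P.1 + 1 ∧ P.2.2.1 < P.2.2.2 ∧ P.2.2.2 < P.2.2.1 + 1) ∧
    P.2.2.2 - P.2.2.1 ≠ P.2.1 - P.1 ∧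
    Irrational (rotNum (twoBreakMap P.1 P.2.1 P.2.2.1 P.2.2.2))}

theorem measurableSet_irrationalParameters : MeasurableSet irrationalParameters := by
  have hirr : MeasurableSet {x : ℝ | Irrational x} := (countable_range _).measurableSet.compl
  simp only [irrationalParameters, ne_eq, measurableSet_setOfPred]
  refine Measurable.and (.and ?_ (.and ?_ (.and ?_ ?_)))
    (.and (.not ?_) (hirr.mem.comp measurable_rotNum_twoBreakMap))
  · exact Measurable.lt (by fun_prop) (by fun_prop)
  · exact Measurable.lt (by fun_prop) (by fun_prop)
  · exact Measurable.lt (by fun_prop) (by fun_prop)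
  · exact Measurable.lt (by fun_prop) (by fun_prop)
  · exact Measurable.eq (by fun_prop) (by fun_prop)

theorem isAddHaarMeasure_volume_real_four :
    (volume : Measure (ℝ × ℝ × ℝ × ℝ)).IsAddHaarMeasure := by
  have h₂ : (volume : Measure (ℝ × ℝ)).IsAddHaarMeasure :=
    Measure.prod.instIsAddHaarMeasure volume volume
  have h₃ : (volume : Measure (ℝ × ℝ × ℝ)).IsAddHaarMeasure :=
    Measure.prod.instIsAddHaarMeasure volume volume
  exact Measure.prod.instIsAddHaarMeasure volume volume

theorem volume_irrationalParameters : volume irrationalParameters = 0 := by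
  have := isAddHaarMeasure_volume_real_four
  let L : ℝ →ₗ[ℝ] ℝ × ℝ × ℝ × ℝ := LinearMap.toSpanSingleton ℝ _ (0, 0, 1, 1)
  have hae := ae_mem_of_ae_add_linearMap_mem L volume volume
    measurableSet_irrationalParameters.compl ?_
  · simpa [ae_iff] using hae
  rintro ⟨x₁, x₂, y₁, y₂⟩
  rw [ae_iff]
  have hL : ∀ t, (x₁, x₂, y₁, y₂) + L t = (x₁, x₂, y₁ + t, y₂ + t) := fun t => by
    simp [L]
  by_cases hP : (x₁ < x₂ ∧ x₂ < x₁ + 1 ∧ y₁ < y₂ ∧ y₂ < y₁ + 1) ∧ y₂ - y₁ ≠ x₂ - x₁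
  · obtain ⟨⟨hx, hx', hy, hy'⟩, hne⟩ := hP
    refine measure_mono_null ?_
      ((isTwoBreak_twoBreakMap hx hx' hy hy').volume_irrational_rotNum_eq_zero ?_)
    · intro t ht
      rw [mem_ofPred_eq, hL, notMem_compl_iff] at ht
      have := ht.2.2
      rwa [twoBreakMap_add_const] at this
    · rw [ne_eq, div_eq_div_iff (by linarith) (by linarith)]
      contrapose! hne
      linarith
  · convert measure_empty (μ := (volume : Measure ℝ))
    ext t
    simp only [mem_ofPred_eq, hL, mem_empty_iff_false, iff_false, not_not]
    rintro ⟨⟨h₁, h₂, h₃, h₄⟩, h₅, -⟩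
    refine hP ⟨⟨h₁, h₂, ?_, ?_⟩, ?_⟩
    · simpa using h₃
    · simp only at h₄; linarith
    · simpa using h₅

theorem volume_equal_gaps :
    volume {P : ℝ × ℝ × ℝ × ℝ | P.2.2.2 - P.2.2.1 = P.2.1 - P.1} = 0 := by
  have := isAddHaarMeasure_volume_real_four
  let L : ℝ →ₗ[ℝ] ℝ × ℝ × ℝ × ℝ := LinearMap.toSpanSingleton ℝ _ (0, 0, 0, 1)
  have hmeas : MeasurableSet {P : ℝ × ℝ × ℝ × ℝ | P.2.2.2 - P.2.2.1 = P.2.1 - P.1} :=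
    measurableSet_eq_fun (by fun_prop) (by fun_prop)
  have hae := ae_mem_of_ae_add_linearMap_mem L volume volume hmeas.compl ?_
  · simpa [ae_iff] using hae
  rintro ⟨x₁, x₂, y₁, y₂⟩
  rw [ae_iff]
  refine measure_mono_null ?_ (measure_singleton (y₁ + (x₂ - x₁) - y₂))
  intro t ht
  simp [L] at ht
  rw [mem_singleton_iff]
  linarith

/-- The set of parameters `(x₁, x₂, y₁, y₂)` with `0 ≤ x₁ < x₂ < 1`, `y₁ < y₂ < y₁ + 1`
for which the piecewise affine circle homeomorphism with break points `x₁, x₂` and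
images `y₁, y₂` is minimal has Lebesgue measure zero in `ℝ⁴`. -/
theorem minimal_two_break_measure_zero :
    volume {p : ℝ × ℝ × ℝ × ℝ |
      (0 ≤ p.1 ∧ p.1 < p.2.1 ∧ p.2.1 < 1 ∧ p.2.2.1 < p.2.2.2 ∧ p.2.2.2 < p.2.2.1 + 1) ∧
      ∃ F : ℝ → ℝ, ∃ f : Circle1 → Circle1,
        IsPiecewiseAffineTwoBreakLift p.1 p.2.1 p.2.2.1 p.2.2.2 F ∧ Induces F f ∧
          MinimalCircleMap f} = 0 := by
  refine measure_mono_null ?_ (measure_union_null volume_irrationalParameters volume_equal_gaps)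
  rintro ⟨x₁, x₂, y₁, y₂⟩ ⟨⟨h₀, hx, hx₁, hy, hy'⟩, F, f, hF, hf, hmin⟩
  simp only at h₀ hx hx₁ hy hy' hF
  have hx' : x₂ < x₁ + 1 := by linarith
  by_cases hgap : y₂ - y₁ = x₂ - x₁
  · exact Or.inr hgap
  · refine Or.inl ⟨⟨hx, hx', hy, hy'⟩, hgap, ?_⟩
    have hirr := (hF.isTwoBreak hx hx' hy hy').irrational_rotNum_of_minimal hf hmin
    rwa [hF.eq_twoBreakMap hx hx' hy hy'] at hirr
end

section
/- Let f be a piecewise affine orientation-preserving homeomorphism of the circle ℝ/ℤ with finitely many break points. If the rotation number of f is irrational, then f is minimal, i.e. every orbit {fⁿ(x) : n ∈ ℤ} is dense in ℝ/ℤ. -/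
open Filter

/-- The set `B + ℤ` of lifts of the break points. -/
def BreakLattice (B : Set ℝ) : Set ℝ :=
  {z : ℝ | ∃ b ∈ B, ∃ n : ℤ, z = b + n}

/-- `F` is affine on each connected component of `ℝ \ (B + ℤ)`: it is affine on every
connected subset of `ℝ` disjoint from `B + ℤ`. -/
def PiecewiseAffineLift (F : ℝ → ℝ) (B : Set ℝ) : Prop :=
  ∀ s : Set ℝ, IsPreconnected s → Disjoint s (BreakLattice B) →
    ∃ a c : ℝ, ∀ x ∈ s, F x = a * x + c

/-- Arbitrarily late strict record times of `k ↦ dist (k * ρ) ℤ`. -/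
theorem Irrational.exists_closest_return {ρ : ℝ} (hρ : Irrational ρ) (N : ℕ) :
    ∃ q : ℕ, N < q ∧ ∃ p : ℤ, ∀ j : ℕ, 0 < j → j < q → ∀ m : ℤ,
      |(q : ℝ) * ρ - p| < |(j : ℝ) * ρ - m| := by
  obtain ⟨ε, hε, hN⟩ : ∃ ε : ℝ, 0 < ε ∧ ∀ j : ℕ, 0 < j → j ≤ N → ∀ m : ℤ,
      ε ≤ |(j : ℝ) * ρ - m| := by
    induction N with
    | zero => exact ⟨1, one_pos, fun j hj hj' => by omega⟩
    | succ N ih =>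
      obtain ⟨ε, hε, ih⟩ := ih
      have hirr : Irrational (((N + 1 : ℕ) : ℝ) * ρ) := hρ.natCast_mul (Nat.succ_ne_zero N)
      refine ⟨min ε |((N + 1 : ℕ) : ℝ) * ρ - round (((N + 1 : ℕ) : ℝ) * ρ)|,
        lt_min hε (abs_pos.2 (sub_ne_zero.2 (hirr.ne_int _))), fun j hj hj' m => ?_⟩
      rcases Nat.lt_or_ge N j with h | h
      · obtain rfl : j = N + 1 := by omega
        exact (min_le_right _ _).trans (round_le _ m)
      · exact (min_le_left _ _).trans (ih j hj h m)
  have hex : ∃ q : ℕ, 0 < q ∧ ∃ p : ℤ, |(q : ℝ) * ρ - p| < ε := by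
    obtain ⟨n, hn⟩ := exists_nat_gt (1 / ε)
    have hn0 : 0 < n := by
      have : (0 : ℝ) < n := (by positivity : (0 : ℝ) < 1 / ε).trans hn
      exact_mod_cast this
    obtain ⟨k, hk, -, hle⟩ := Real.exists_nat_abs_mul_sub_round_le ρ hn0
    refine ⟨k, hk, _, hle.trans_lt ?_⟩
    rw [div_lt_iff₀ (by positivity)]
    rw [div_lt_iff₀ hε] at hn
    nlinarith
  classical
  obtain ⟨hq, p, hp⟩ := Nat.find_spec hex
  refine ⟨Nat.find hex, ?_, p, fun j hj hjq m => ?_⟩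
  · by_contra! h
    exact (hN _ hq h p).not_gt hp
  · have := Nat.find_min hex hjq
    push Not at this
    exact hp.trans_le (this hj m)

theorem BreakLattice.finite_inter_Icc {B : Set ℝ} (hB : B.Finite) (x y : ℝ) :
    (BreakLattice B ∩ Set.Icc x y).Finite := by
  obtain ⟨C, hC⟩ := hB.isBounded.exists_norm_le
  refine ((hB.prod (Set.finite_Icc ⌊x - C⌋ ⌈y + C⌉)).image
    fun z : ℝ × ℤ => z.1 + z.2).subset ?_
  rintro _ ⟨⟨b, hb, n, rfl⟩, h₁, h₂⟩
  have := abs_le.1 (hC b hb)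
  refine ⟨(b, n), ⟨hb, ?_, ?_⟩, rfl⟩
  · have : (⌊x - C⌋ : ℝ) ≤ n := (Int.floor_le _).trans (by linarith)
    exact_mod_cast this
  · have : (n : ℝ) ≤ ⌈y + C⌉ := le_trans (by linarith) (Int.le_ceil _)
    exact_mod_cast this

theorem BreakLattice.exists_punctured_ball_disjoint {B : Set ℝ} (hB : B.Finite) (x : ℝ) :
    ∃ r : ℝ, 0 < r ∧ ∀ y ∈ BreakLattice B, |y - x| < r → y = x := by
  have hfin := (BreakLattice.finite_inter_Icc hB (x - 1) (x + 1)).subset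
    (Set.sdiff_subset (t := {x}))
  obtain ⟨r, hr, hball⟩ := Metric.isOpen_iff.1 hfin.isClosed.isOpen_compl x (by simp)
  refine ⟨min r 1, lt_min hr one_pos, fun y hy hyx => ?_⟩
  by_contra hne
  have h1 := abs_lt.1 (hyx.trans_le (min_le_right _ _))
  refine hball (show y ∈ Metric.ball x r from hyx.trans_le (min_le_left _ _)) ⟨⟨hy, ?_, ?_⟩, hne⟩
  · linarith
  · linarith

/-- On an interval whose interior avoids the break points, a lift has constant positive slope. -/
theorem PiecewiseAffineLift.exists_slope {F : ℝ → ℝ} {B : Set ℝ} (hF : IsLift F)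
    (hPA : PiecewiseAffineLift F B) {x y : ℝ} (hxy : x < y)
    (hdisj : Disjoint (Set.Ioo x y) (BreakLattice B)) :
    ∃ a : ℝ, 0 < a ∧ ∀ s ∈ Set.Icc x y, ∀ t ∈ Set.Icc x y, F t - F s = a * (t - s) := by
  obtain ⟨a, c, hac⟩ := hPA _ isPreconnected_Ioo hdisj
  have hIcc : Set.EqOn F (fun z => a * z + c) (Set.Icc x y) := by
    have := Set.EqOn.closure (s := Set.Ioo x y) (f := F) (g := fun z => a * z + c) hac
      hF.1 (by fun_prop)
    rwa [closure_Ioo hxy.ne] at this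
  have hslope : ∀ s ∈ Set.Icc x y, ∀ t ∈ Set.Icc x y, F t - F s = a * (t - s) := by
    intro s hs t ht
    rw [hIcc hs, hIcc ht]
    ring
  refine ⟨a, ?_, hslope⟩
  have h1 := hslope x (Set.left_mem_Icc.2 hxy.le) y (Set.right_mem_Icc.2 hxy.le)
  have h2 := hF.2.1 hxy
  by_contra! ha
  nlinarith

theorem IsLift.map_add_int {F : ℝ → ℝ} (hF : IsLift F) (x : ℝ) (n : ℤ) :
    F (x + n) = F x + n :=
  (⟨⟨F, hF.2.1.monotone⟩, hF.2.2⟩ : CircleDeg1Lift).map_add_int x n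

/-- A piecewise affine lift with finitely many break points is bi-Lipschitz on unit scale. -/
theorem PiecewiseAffineLift.exists_bilipschitz {F : ℝ → ℝ} {B : Set ℝ} (hB : B.Finite)
    (hF : IsLift F) (hPA : PiecewiseAffineLift F B) :
    ∃ a A : ℝ, 0 < a ∧ ∀ y z : ℝ, y < z → z ≤ y + 1 →
      a * (z - y) ≤ F z - F y ∧ F z - F y ≤ A * (z - y) := by
  have hcpt : ∃ a A : ℝ, 0 < a ∧ ∀ y ∈ Set.Icc (0 : ℝ) 1, ∀ z : ℝ, y < z → z ≤ y + 1 →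
      a * (z - y) ≤ F z - F y ∧ F z - F y ≤ A * (z - y) := by
    refine isCompact_Icc.induction_on
      (p := fun s => ∃ a A : ℝ, 0 < a ∧ ∀ y ∈ s, ∀ z : ℝ, y < z → z ≤ y + 1 →
        a * (z - y) ≤ F z - F y ∧ F z - F y ≤ A * (z - y)) ⟨1, 1, by simp⟩ ?_ ?_ ?_
    · rintro s t hst ⟨a, A, ha, h⟩
      exact ⟨a, A, ha, fun y hy => h y (hst hy)⟩
    · rintro s t ⟨a, A, ha, h⟩ ⟨a', A', ha', h'⟩
      refine ⟨min a a', max A A', lt_min ha ha', fun y hy z hyz hz => ?_⟩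
      have hpos := sub_pos.2 hyz
      have h1 := mul_le_mul_of_nonneg_right (min_le_left a a') hpos.le
      have h2 := mul_le_mul_of_nonneg_right (min_le_right a a') hpos.le
      have h3 := mul_le_mul_of_nonneg_right (le_max_left A A') hpos.le
      have h4 := mul_le_mul_of_nonneg_right (le_max_right A A') hpos.le
      rcases hy with hy | hy
      · obtain ⟨h5, h6⟩ := h y hy z hyz hz
        constructor <;> linarith
      · obtain ⟨h5, h6⟩ := h' y hy z hyz hz
        constructor <;> linarith
    · intro x _
      obtain ⟨r, hr, hball⟩ := BreakLattice.exists_punctured_ball_disjoint hB x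
      obtain ⟨a, ha, hleft⟩ := hPA.exists_slope hF (sub_lt_self x hr) <| by
        rw [Set.disjoint_left]
        intro y hy hyB
        exact hy.2.ne (hball y hyB (abs_lt.2 ⟨by linarith [hy.1], by linarith [hy.2]⟩))
      obtain ⟨b, hb, hright⟩ := hPA.exists_slope hF (lt_add_of_pos_right x hr) <| by
        rw [Set.disjoint_left]
        intro y hy hyB
        exact hy.1.ne' (hball y hyB (abs_lt.2 ⟨by linarith [hy.1], by linarith [hy.2]⟩))
      have hloc : ∀ y z : ℝ, x - r ≤ y → y < z → z ≤ x + r →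
          min a b * (z - y) ≤ F z - F y ∧ F z - F y ≤ max a b * (z - y) := by
        have hside : ∀ y z : ℝ, y ≤ z → ((x - r ≤ y ∧ z ≤ x) ∨ (x ≤ y ∧ z ≤ x + r)) →
            min a b * (z - y) ≤ F z - F y ∧ F z - F y ≤ max a b * (z - y) := by
          rintro y z hyz (⟨h1, h2⟩ | ⟨h1, h2⟩)
          · rw [hleft y ⟨h1, by linarith⟩ z ⟨by linarith, h2⟩]
            exact ⟨mul_le_mul_of_nonneg_right (min_le_left _ _) (sub_nonneg.2 hyz),
              mul_le_mul_of_nonneg_right (le_max_left _ _) (sub_nonneg.2 hyz)⟩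
          · rw [hright y ⟨h1, by linarith⟩ z ⟨by linarith, h2⟩]
            exact ⟨mul_le_mul_of_nonneg_right (min_le_right _ _) (sub_nonneg.2 hyz),
              mul_le_mul_of_nonneg_right (le_max_right _ _) (sub_nonneg.2 hyz)⟩
        intro y z h1 hyz h2
        rcases le_total z x with hz | hz
        · exact hside y z hyz.le (Or.inl ⟨h1, hz⟩)
        rcases le_total x y with hy | hy
        · exact hside y z hyz.le (Or.inr ⟨hy, h2⟩)
        obtain ⟨h3, h4⟩ := hside y x hy (Or.inl ⟨h1, le_rfl⟩)
        obtain ⟨h5, h6⟩ := hside x z hz (Or.inr ⟨le_rfl, h2⟩)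
        constructor <;> linarith
      have hm : 0 < min a b := lt_min ha hb
      have hM : 0 < max a b := ha.trans_le (le_max_left _ _)
      refine ⟨Metric.ball x (r / 2), mem_nhdsWithin_of_mem_nhds
          (Metric.ball_mem_nhds x (half_pos hr)),
        min (min a b) (min a b * (r / 2)), max (max a b) (2 / r),
        lt_min hm (by positivity), fun y hy z hyz hz => ?_⟩
      have hy' := abs_lt.1 (show |y - x| < r / 2 from hy)
      have hpos := sub_pos.2 hyz
      rcases le_total z (y + r / 2) with h | h
      · obtain ⟨h1, h2⟩ := hloc y z (by linarith) hyz (by linarith)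
        exact ⟨(mul_le_mul_of_nonneg_right (min_le_left _ _) hpos.le).trans h1,
          h2.trans (mul_le_mul_of_nonneg_right (le_max_left _ _) hpos.le)⟩
      · constructor
        · have h1 := (hloc y (y + r / 2) (by linarith) (by linarith) (by linarith)).1
          have h2 := hF.2.1.monotone h
          have h3 := mul_le_mul_of_nonneg_right
            (min_le_right (min a b) (min a b * (r / 2))) hpos.le
          have h4 : min a b * (r / 2) * (z - y) ≤ min a b * (r / 2) :=
            mul_le_of_le_one_right (by positivity) (by linarith)
          have h5 : y + r / 2 - y = r / 2 := by ring
          rw [h5] at h1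
          linarith
        · have h1 := hF.2.1.monotone hz
          rw [hF.2.2] at h1
          have h2 := mul_le_mul_of_nonneg_right (le_max_right (max a b) (2 / r)) hpos.le
          have h3 : 1 ≤ 2 / r * (z - y) := by
            rw [div_mul_eq_mul_div, le_div_iff₀ hr]
            linarith
          linarith
  obtain ⟨a, A, ha, h⟩ := hcpt
  refine ⟨a, A, ha, fun y z hyz hz => ?_⟩
  have key := h (Int.fract y) ⟨Int.fract_nonneg y, (Int.fract_lt_one y).le⟩ (z - ⌊y⌋)
    (by rw [← Int.self_sub_floor]; linarith) (by rw [← Int.self_sub_floor]; linarith)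
  have e1 : F y = F (Int.fract y) + ⌊y⌋ := by rw [← hF.map_add_int, Int.fract_add_floor]
  have e2 : F z = F (z - ⌊y⌋) + ⌊y⌋ := by rw [← hF.map_add_int, sub_add_cancel]
  have e3 : z - ⌊y⌋ - Int.fract y = z - y := by rw [← Int.self_sub_floor]; ring
  rw [e3] at key
  rw [e1, e2]
  constructor <;> linarith [key.1, key.2]

section Semiconj

variable {e : ℝ ≃o ℝ} {h : CircleDeg1Lift} {ρ : ℝ}

theorem semiconj_translation_zpow (he : ∀ x, h (e x) = h x + ρ) (k : ℤ) (x : ℝ) :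
    h ((e ^ k) x) = h x + k * ρ := by
  induction k with
  | zero => simp
  | succ n ih =>
    rw [add_comm, zpow_add, zpow_one, RelIso.mul_apply, he, ih]
    push_cast
    ring
  | pred n ih =>
    have := he ((e ^ (-(n : ℤ) - 1)) x)
    rw [← RelIso.mul_apply, ← zpow_one_add, add_sub_cancel, ih] at this
    push_cast at this ⊢
    linarith

/-- An interval collapsed by a semiconjugacy to an irrational rotation is wandering, so only
finitely many of its images have length at least `ε`. -/
theorem finite_long_images (hρ : Irrational ρ) (he : ∀ x, h (e x) = h x + ρ) {u v : ℝ}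
    (huv : h u = h v) {ε : ℝ} (hε : 0 < ε) :
    {k : ℤ | ε ≤ (e ^ k) v - (e ^ k) u}.Finite := by
  have hsep : ∀ k l : ℤ, k ≠ l → ε ≤ (e ^ k) v - (e ^ k) u →
      Int.fract ((e ^ k) u) ≤ Int.fract ((e ^ l) u) →
      Int.fract ((e ^ k) u) + ε ≤ Int.fract ((e ^ l) u) := by
    intro k l hkl hk hle
    by_contra! hlt
    have h1 := h.monotone hle
    have h2 : h (Int.fract ((e ^ l) u)) ≤ h ((e ^ k) v - ⌊(e ^ k) u⌋) :=
      h.monotone (by linarith [Int.self_sub_floor ((e ^ k) u)])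
    rw [← Int.self_sub_floor, ← Int.self_sub_floor, h.map_sub_int, h.map_sub_int,
      semiconj_translation_zpow he, semiconj_translation_zpow he] at h1
    rw [← Int.self_sub_floor, h.map_sub_int, h.map_sub_int,
      semiconj_translation_zpow he, semiconj_translation_zpow he] at h2
    have hirr : Irrational (((k - l : ℤ) : ℝ) * ρ) := hρ.intCast_mul (sub_ne_zero.2 hkl)
    refine hirr.ne_int (⌊(e ^ k) u⌋ - ⌊(e ^ l) u⌋) ?_
    push_cast
    linarith
  refine Set.Finite.of_finite_image (f := fun k => ⌊Int.fract ((e ^ k) u) / ε⌋)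
    ((Set.finite_Icc 0 ⌊1 / ε⌋).subset ?_) ?_
  · rintro _ ⟨k, -, rfl⟩
    refine ⟨Int.floor_nonneg.2 (div_nonneg (Int.fract_nonneg _) hε.le), Int.floor_le_floor ?_⟩
    gcongr
    exact (Int.fract_lt_one _).le
  · have hfloor : ∀ k l : ℤ, k ≠ l → ε ≤ (e ^ k) v - (e ^ k) u →
        Int.fract ((e ^ k) u) ≤ Int.fract ((e ^ l) u) →
        ⌊Int.fract ((e ^ k) u) / ε⌋ < ⌊Int.fract ((e ^ l) u) / ε⌋ := by
      intro k l hkl hk hle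
      rw [← Int.add_one_le_iff, ← Int.floor_add_one]
      refine Int.floor_le_floor ?_
      rw [le_div_iff₀ hε, add_mul, div_mul_cancel₀ _ hε.ne', one_mul]
      exact hsep k l hkl hk hle
    intro k hk l hl hkl
    by_contra hne
    rcases le_total (Int.fract ((e ^ k) u)) (Int.fract ((e ^ l) u)) with hle | hle
    · exact (hfloor k l hne hk hle).ne hkl
    · exact (hfloor l k (Ne.symm hne) hl hle).ne' hkl

theorem BreakLattice.card_filter_hit_le {B : Set ℝ} (hB : B.Finite) {q : ℕ} {p : ℤ}
    (hq : ∀ j : ℕ, 0 < j → j < q → ∀ m : ℤ, |(q : ℝ) * ρ - p| < |(j : ℝ) * ρ - m|)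
    (t : ℝ) (s : Finset ℕ) (hsq : s ⊆ Finset.range q)
    (hs : ∀ k ∈ s, ∃ z ∈ BreakLattice B,
      h z ∈ Set.uIcc (t + k * ρ - (q * ρ - p)) (t + k * ρ)) :
    s.card ≤ hB.toFinset.card := by
  have hs' : ∀ k ∈ s, ∃ b ∈ B, ∃ n : ℤ,
      h b + n ∈ Set.uIcc (t + k * ρ - (q * ρ - p)) (t + k * ρ) := by
    intro k hk
    obtain ⟨_, ⟨b, hb, n, rfl⟩, hz⟩ := hs k hk
    exact ⟨b, hb, n, by rwa [← h.map_add_int]⟩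
  choose! b hb n hn using hs'
  have hlt : ∀ k ∈ s, ∀ l ∈ s, k < l → b k ≠ b l := by
    intro k hk l hl hkl hbb
    have hlq := Finset.mem_range.1 (hsq hl)
    have h3 := hq (l - k) (by omega) (by omega) (n l - n k)
    rw [Nat.cast_sub hkl.le] at h3
    have h1 := hn k hk
    have h2 := hn l hl
    rw [hbb] at h1
    push_cast at h3
    rw [Set.mem_uIcc] at h1 h2
    refine h3.not_ge (abs_le.2 ?_)
    rcases le_total 0 ((q : ℝ) * ρ - p) with hδ | hδ
    · rw [abs_of_nonneg hδ]
      rcases h1 with h1 | h1 <;> rcases h2 with h2 | h2 <;> constructor <;>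
        linarith [h1.1, h1.2, h2.1, h2.2]
    · rw [abs_of_nonpos hδ]
      rcases h1 with h1 | h1 <;> rcases h2 with h2 | h2 <;> constructor <;>
        linarith [h1.1, h1.2, h2.1, h2.2]
  refine Finset.card_le_card_of_injOn b (fun k hk => hB.mem_toFinset.2 (hb k hk)) ?_
  intro k hk l hl hkl
  rcases lt_trichotomy k l with hlt' | heq | hlt'
  · exact (hlt k hk l hl hlt' hkl).elim
  · exact heq
  · exact (hlt l hl k hk hlt' hkl.symm).elim

/-- Denjoy's inequality for an interval collapsed by the semiconjugacy: at closest return times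
`q`, the lengths of its images under the `q`-th and `-q`-th iterates cannot both be small. -/
theorem PiecewiseAffineLift.denjoy_inequality {B : Set ℝ} (hB : B.Finite)
    (hF : IsLift e) (hPA : PiecewiseAffineLift e B) (he : ∀ x, h (e x) = h x + ρ)
    {a A : ℝ} (ha : 0 < a)
    (hbl : ∀ y z : ℝ, y < z → z ≤ y + 1 → a * (z - y) ≤ e z - e y ∧ e z - e y ≤ A * (z - y))
    {u v : ℝ} (huv : u < v) (hhuv : h u = h v) {q : ℕ} {p : ℤ}
    (hq : ∀ j : ℕ, 0 < j → j < q → ∀ m : ℤ, |(q : ℝ) * ρ - p| < |(j : ℝ) * ρ - m|) :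
    (a / A) ^ hB.toFinset.card * (v - u) ^ 2 ≤
      ((e ^ (q : ℤ)) v - (e ^ (q : ℤ)) u) * ((e ^ (-q : ℤ)) v - (e ^ (-q : ℤ)) u) := by
  classical
  set L : ℤ → ℝ := fun k => (e ^ k) v - (e ^ k) u with hL
  have hLpos : ∀ k, 0 < L k := fun k => sub_pos.2 ((e ^ k).strictMono huv)
  have hstep : ∀ (k : ℤ) x, (e ^ (k + 1)) x = e ((e ^ k) x) := fun k x => by
    rw [add_comm, zpow_one_add, RelIso.mul_apply]
  have hh : ∀ k : ℤ, h ((e ^ k) u) = h u + k * ρ ∧ h ((e ^ k) v) = h u + k * ρ := fun k =>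
    ⟨semiconj_translation_zpow he k u, hhuv ▸ semiconj_translation_zpow he k v⟩
  have hLstep : ∀ k, a * L k ≤ L (k + 1) ∧ L (k + 1) ≤ A * L k := by
    intro k
    simp only [hL, hstep]
    refine hbl _ _ ((e ^ k).strictMono huv) ?_
    by_contra! hlt
    have := h.monotone hlt.le
    rw [h.map_add_one, (hh k).1, (hh k).2] at this
    linarith
  set s : ℤ → ℝ := fun k => L (k + 1) / L k with hs
  have hspos : ∀ k, 0 < s k := fun k => div_pos (hLpos _) (hLpos _)
  have hsa : ∀ k, a ≤ s k := fun k => (le_div_iff₀ (hLpos k)).2 (hLstep k).1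
  have hsA : ∀ k, s k ≤ A := fun k => (div_le_iff₀ (hLpos k)).2 (hLstep k).2
  have hA : 0 < A := (hspos 0).trans_le (hsA 0)
  have hc : 0 < a / A := div_pos ha hA
  have hc1 : a / A ≤ 1 := (div_le_one hA).2 ((hsa 0).trans (hsA 0))
  have htel : ∀ (j : ℤ) (n : ℕ), ∏ k ∈ Finset.range n, s (j + k) = L (j + n) / L j := by
    intro j n
    induction n with
    | zero => simp [(hLpos j).ne']
    | succ n ih =>
      rw [Finset.prod_range_succ, ih, hs, Nat.cast_succ, ← add_assoc]
      have := (hLpos (j + n)).ne'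
      have := (hLpos j).ne'
      field_simp
  let S : ℕ → Set ℝ := fun k => h ⁻¹' Set.uIcc (h u + k * ρ - (q * ρ - p)) (h u + k * ρ)
  have hgood : ∀ k : ℕ, Disjoint (S k) (BreakLattice B) → s k = s (-q + k) := by
    intro k hk
    obtain ⟨α, β, hαβ⟩ := hPA (S k)
      ((Set.ordConnected_uIcc.preimage_mono h.monotone).isPreconnected) hk
    have hmem : (e ^ (k : ℤ)) u ∈ S k ∧ (e ^ (k : ℤ)) v ∈ S k := by
      simp [S, -zpow_natCast, (hh k).1, (hh k).2]
    have hmem' : (e ^ (-q + k : ℤ)) u + p ∈ S k ∧ (e ^ (-q + k : ℤ)) v + p ∈ S k := by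
      have : h u + ((-q + k : ℤ) : ℝ) * ρ + p = h u + k * ρ - (q * ρ - p) := by
        push_cast
        ring
      simp [S, -Int.cast_add, h.map_add_int, (hh (-q + k)).1, (hh (-q + k)).2, this]
    have h1 : L (k + 1) = α * L k := by
      simp only [hL, hstep, hαβ _ hmem.1, hαβ _ hmem.2]
      ring
    have h2 : L (-q + k + 1) = α * L (-q + k) := by
      have e1 := hαβ _ hmem'.1
      have e2 := hαβ _ hmem'.2
      rw [hF.map_add_int] at e1 e2
      simp only [hL, hstep]
      linarith
    simp only [hs, h1, h2]
    rw [mul_div_cancel_right₀ _ (hLpos _).ne', mul_div_cancel_right₀ _ (hLpos _).ne']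
  set bad := (Finset.range q).filter fun k => ¬ Disjoint (S k) (BreakLattice B)
  have hcard : bad.card ≤ hB.toFinset.card := by
    refine BreakLattice.card_filter_hit_le (h := h) hB hq (h u) bad (Finset.filter_subset _ _) ?_
    intro k hk
    obtain ⟨z, hz, hz'⟩ := Set.not_disjoint_iff.1 (Finset.mem_filter.1 hk).2
    exact ⟨z, hz', hz⟩
  have hprod : (a / A) ^ bad.card ≤ ∏ k ∈ Finset.range q, s k / s (-q + k) := by
    calc (a / A) ^ bad.card
        = ∏ k ∈ Finset.range q, if ¬ Disjoint (S k) (BreakLattice B) then a / A else 1 := by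
          rw [← Finset.prod_filter, Finset.prod_const]
      _ ≤ _ := by
          refine Finset.prod_le_prod (fun k _ => by split_ifs <;> positivity) fun k _ => ?_
          split_ifs with hk
          · rw [hgood k hk, div_self (hspos _).ne']
          · exact div_le_div₀ (hspos _).le (hsa _) (hspos _) (hsA _)
  have h1 := htel 0 q
  have h2 := htel (-q) q
  simp only [zero_add, neg_add_cancel] at h1 h2
  rw [Finset.prod_div_distrib, h1, h2] at hprod
  have hL0 : L 0 = v - u := by simp [hL]
  have hfin := (pow_le_pow_of_le_one hc.le hc1 hcard).trans hprod
  rw [hL0] at hfin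
  have huv' := sub_pos.2 huv
  calc _ ≤ L q / (v - u) / ((v - u) / L (-q)) * (v - u) ^ 2 := by gcongr
    _ = L q * L (-q) := by
      have := (hLpos (-q)).ne'
      field_simp

theorem PiecewiseAffineLift.injective_semiconj {B : Set ℝ} (hB : B.Finite)
    (hF : IsLift e) (hPA : PiecewiseAffineLift e B) (hρ : Irrational ρ)
    (he : ∀ x, h (e x) = h x + ρ) : Function.Injective h := by
  refine Function.Injective.of_lt_imp_ne fun u v huv hhuv => ?_
  obtain ⟨a, A, ha, hbl⟩ := hPA.exists_bilipschitz hB hF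
  have hA : 0 < A := by
    have h1 := hbl 0 1 one_pos (by simp)
    linarith
  have huv' := sub_pos.2 huv
  set ε := (a / A) ^ hB.toFinset.card * (v - u) ^ 2
  have hε : 0 < ε := by positivity
  have hfin := (finite_long_images hρ he hhuv hε).union
    (finite_long_images hρ he hhuv one_pos)
  obtain ⟨N, hN⟩ := hfin.isBounded.exists_norm_le
  obtain ⟨q, hNq, p, hq⟩ := hρ.exists_closest_return ⌈N⌉₊
  have hNq' : N < q := Nat.lt_of_ceil_lt hNq
  have hsmall : ∀ k : ℤ, N < |(k : ℝ)| →
      (e ^ k) v - (e ^ k) u < ε ∧ (e ^ k) v - (e ^ k) u < 1 := by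
    intro k hk
    constructor <;> by_contra! hle
    · exact hk.not_ge (Int.norm_eq_abs k ▸ hN k (Or.inl hle))
    · exact hk.not_ge (Int.norm_eq_abs k ▸ hN k (Or.inr hle))
  have h1 := (hsmall q (by simpa using hNq')).1
  have h2 := (hsmall (-q) (by simpa using hNq')).2
  have h3 := hPA.denjoy_inequality hB hF he ha hbl huv hhuv hq
  have h4 : 0 < (e ^ (q : ℤ)) v - (e ^ (q : ℤ)) u := sub_pos.2 ((e ^ (q : ℤ)).strictMono huv)
  have h5 := mul_le_of_le_one_right h4.le h2.le
  linarith

end Semiconj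

theorem IsLift.surjective {F : ℝ → ℝ} (hF : IsLift F) : Function.Surjective F :=
  (⟨⟨F, hF.2.1.monotone⟩, hF.2.2⟩ : CircleDeg1Lift).continuous_iff_surjective.1 hF.1

theorem Induces.iterate {F : ℝ → ℝ} {f : Circle1 → Circle1} (hf : Induces F f) (n : ℕ) (x : ℝ) :
    f^[n] (x : Circle1) = (F^[n] x : ℝ) :=
  (Function.Semiconj.iterate_right (f := fun y : ℝ => (y : Circle1)) (ga := F) (gb := f)
    (fun y => (hf y).symm) n x).symm

theorem Irrational.exists_int_mul_add_mem_Ioo {ρ : ℝ} (hρ : Irrational ρ) {x y : ℝ}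
    (hxy : x < y) : ∃ k m : ℤ, k * ρ + m ∈ Set.Ioo x y := by
  have hd : Dense (AddSubgroup.closure {ρ, 1} : Set ℝ) :=
    dense_addSubgroupClosure_pair_iff.2 (by simpa using hρ)
  obtain ⟨z, hz, hzxy⟩ := hd.exists_between hxy
  obtain ⟨k, m, rfl⟩ := AddSubgroup.mem_closure_pair.1 hz
  exact ⟨k, m, by simpa using hzxy⟩

/-- A piecewise affine orientation-preserving circle homeomorphism with finitely many
break points and irrational rotation number is minimal. -/
theorem piecewise_affine_irrational_rotation_number_minimal
    (F : ℝ → ℝ) (f : Circle1 → Circle1) (B : Set ℝ)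
    (hBfin : B.Finite) (hB : B ⊆ Set.Ico (0 : ℝ) 1)
    (hF : IsLift F) (hPA : PiecewiseAffineLift F B) (hf : Induces F f)
    (ρ : ℝ) (hρ : Irrational ρ)
    (hlim : Tendsto (fun n : ℕ => F^[n] 0 / (n : ℝ)) atTop (nhds ρ)) :
    MinimalCircleMap f := by
  let G : CircleDeg1Lift := ⟨⟨F, hF.2.1.monotone⟩, hF.2.2⟩
  have hτ : G.translationNumber = ρ := G.translationNumber_eq_of_tendsto₀ hlim
  obtain ⟨h, hsemi⟩ := CircleDeg1Lift.semiconj_of_bijective_of_translationNumber_eq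
    (f₁ := G) (f₂ := CircleDeg1Lift.translate (Multiplicative.ofAdd ρ))
    ⟨hF.2.1.injective, hF.surjective⟩
    (CircleDeg1Lift.isUnit_iff_bijective.1 (Units.isUnit _))
    (by rw [hτ, CircleDeg1Lift.translationNumber_translate])
  let e : ℝ ≃o ℝ := hF.2.1.orderIsoOfSurjective F hF.surjective
  have he : ∀ x, h (e x) = h x + ρ := fun x =>
    (hsemi x).trans ((CircleDeg1Lift.translate_apply _ _).trans (add_comm _ _))
  have hinj : Function.Injective h := PiecewiseAffineLift.injective_semiconj hBfin
    (e := e) hF hPA hρ he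
  have hmono : StrictMono h := h.monotone.strictMono_of_injective hinj
  have hpow : ∀ (n : ℕ) (x : ℝ), F^[n] x = (e ^ n) x := by
    intro n x
    induction n with
    | zero => rfl
    | succ n ih =>
      rw [Function.iterate_succ_apply', ih, pow_succ']
      rfl
  intro x
  induction x using QuotientAddGroup.induction_on with | _ X => ?_
  rw [dense_iff_inter_open]
  rintro U hU ⟨y, hy⟩
  induction y using QuotientAddGroup.induction_on with | _ Y => ?_
  obtain ⟨r, hr, hball⟩ := Metric.isOpen_iff.1
    (hU.preimage (AddCircle.continuous_mk' (1 : ℝ))) Y hy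
  obtain ⟨k, m, h1, h2⟩ := hρ.exists_int_mul_add_mem_Ioo
    (sub_lt_sub_right (hmono (show Y - r < Y + r by linarith)) (h X))
  have hkm : h ((e ^ k) X + m) = h X + k * ρ + m := by
    rw [h.map_add_int, semiconj_translation_zpow he]
  have hlo : Y - r < (e ^ k) X + m := hmono.lt_iff_lt.1 (by rw [hkm]; linarith)
  have hhi : (e ^ k) X + m < Y + r := hmono.lt_iff_lt.1 (by rw [hkm]; linarith)
  have hmem := hball (show (e ^ k) X + m ∈ Metric.ball Y r from
    Real.ball_eq_Ioo Y r ▸ ⟨hlo, hhi⟩)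
  have hcoe : (((e ^ k) X + m : ℝ) : Circle1) = ((e ^ k) X : ℝ) := by
    rw [AddCircle.coe_add]
    simp
  refine ⟨(((e ^ k) X : ℝ) : Circle1), hcoe ▸ hmem, ?_⟩
  obtain ⟨n, rfl | rfl⟩ := k.eq_nat_or_neg
  · exact ⟨n, Or.inl (by rw [hf.iterate, hpow, zpow_natCast])⟩
  · refine ⟨n, Or.inr ?_⟩
    rw [hf.iterate, hpow, ← zpow_natCast, ← RelIso.mul_apply, ← zpow_add, add_neg_cancel,
      zpow_zero]
    rfl
end

section
/- Let Φ : (0, 2π) × ℝ × (0, ∞) → SL(2,ℝ) be the map Φ(θ, t, ν) = k(θ) n(t) a(ν). Then the pushforward under Φ of the measure with density (θ, t, ν) ↦ 1/ν with respect to Lebesgue measure on (0, 2π) × ℝ × (0, ∞) is a (left-invariant) Haar measure on SL(2,ℝ); equivalently, it equals a positive constant multiple of the Haar measure of SL(2,ℝ). -/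
open Real MeasureTheory

/-- `SL(2, ℝ)`. -/
abbrev SL2 : Type := Matrix.SpecialLinearGroup (Fin 2) ℝ

/-- The topology on `SL(2, ℝ)` induced from the space of 2×2 real matrices. -/
noncomputable instance : TopologicalSpace SL2 :=
  TopologicalSpace.induced (fun g : SL2 => (g : Matrix (Fin 2) (Fin 2) ℝ)) inferInstance

/-- The Borel σ-algebra on `SL(2, ℝ)`. -/
noncomputable instance : MeasurableSpace SL2 := borel SL2

instance : BorelSpace SL2 := ⟨rfl⟩

/-- The rotation `k(θ)` as an element of `SL(2, ℝ)`. -/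
noncomputable def kSL (θ : ℝ) : SL2 :=
  ⟨!![Real.cos θ, -Real.sin θ; Real.sin θ, Real.cos θ], by
    simp [Matrix.det_fin_two_of]
    nlinarith [Real.sin_sq_add_cos_sq θ]⟩

/-- The unipotent `n(t)` as an element of `SL(2, ℝ)`. -/
def nSL (t : ℝ) : SL2 :=
  ⟨!![1, 0; t, 1], by simp [Matrix.det_fin_two_of]⟩

/-- The diagonal `a(ν)` as an element of `SL(2, ℝ)` (junk value `1` if `ν = 0`). -/
noncomputable def aSL (ν : ℝ) : SL2 :=
  if h : ν ≠ 0 then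
    ⟨!![ν, 0; 0, ν⁻¹], by simp [Matrix.det_fin_two_of]; exact mul_inv_cancel₀ h⟩
  else 1

/-- The parametrisation `Φ(θ, t, ν) = k(θ) n(t) a(ν)` of `SL(2, ℝ)`. -/
noncomputable def Φ : ℝ × ℝ × ℝ → SL2 :=
  fun p => kSL p.1 * nSL p.2.1 * aSL p.2.2

section

open Set Filter Topology

/-! ### Topology and measurability of `SL(2, ℝ)` in terms of matrix entries -/

lemma isInducing_SL2_coe :
    IsInducing (fun g : SL2 => (g : Matrix (Fin 2) (Fin 2) ℝ)) := ⟨rfl⟩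

lemma continuous_SL2_entry (i j : Fin 2) : Continuous fun g : SL2 => g i j :=
  (continuous_apply j).comp ((continuous_apply i).comp isInducing_SL2_coe.continuous)

lemma measurable_SL2_entry (i j : Fin 2) : Measurable fun g : SL2 => g i j :=
  (continuous_SL2_entry i j).measurable

lemma continuousAt_SL2_of_entries {α : Type*} [TopologicalSpace α] {f : α → SL2} {x : α}
    (h : ∀ i j, ContinuousAt (fun a => f a i j) x) : ContinuousAt f x :=
  isInducing_SL2_coe.continuousAt_iff.2 <|
    continuousAt_pi.2 fun i => continuousAt_pi.2 fun j => h i j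

lemma measurable_SL2_of_entries {α : Type*} [MeasurableSpace α] {f : α → SL2}
    (h : ∀ i j, Measurable fun a => f a i j) : Measurable f := by
  have hf : Measurable fun a => (fun i j => f a i j : Fin 2 → Fin 2 → ℝ) :=
    measurable_pi_lambda _ fun i => measurable_pi_lambda _ fun j => h i j
  intro s hs
  have hs' : MeasurableSet[(borel (Fin 2 → Fin 2 → ℝ)).comap
      (fun (g : SL2) i j => g i j)] s := by
    rw [← borel_comap]; exact hs
  obtain ⟨t, ht, rfl⟩ := hs'
  rw [← BorelSpace.measurable_eq (α := Fin 2 → Fin 2 → ℝ)] at ht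
  exact hf ht

lemma measurable_SL2_mul_left (g : SL2) : Measurable fun h : SL2 => g * h := by
  refine measurable_SL2_of_entries fun i j => ?_
  simp only [Matrix.SpecialLinearGroup.coe_mul, Matrix.mul_apply, Fin.sum_univ_two]
  exact ((measurable_SL2_entry 0 j).const_mul _).add ((measurable_SL2_entry 1 j).const_mul _)

lemma SL2_det_eq_one (g : SL2) : g 0 0 * g 1 1 - g 0 1 * g 1 0 = 1 := by
  rw [← Matrix.det_fin_two]; exact g.2

/-! ### Coordinates in which Haar measure is Lebesgue measure -/

lemma sq_add_sq_ne_zero_of_ne_zero {u : ℝ × ℝ} (hu : u ≠ 0) : u.1 ^ 2 + u.2 ^ 2 ≠ 0 := by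
  contrapose! hu
  ext <;> simp <;> nlinarith [sq_nonneg u.1, sq_nonneg u.2]

/-- The matrix with second column `(u₂, -u₁)` and first column
`-u / |u|² + s • (u₂, -u₁)` (junk value `1` if `u = 0`). -/
noncomputable def shearSL (z : (ℝ × ℝ) × ℝ) : SL2 :=
  if h : z.1 ≠ 0 then
    ⟨!![-z.1.1 / (z.1.1 ^ 2 + z.1.2 ^ 2) + z.2 * z.1.2, z.1.2;
        -z.1.2 / (z.1.1 ^ 2 + z.1.2 ^ 2) - z.2 * z.1.1, -z.1.1], by
      have := sq_add_sq_ne_zero_of_ne_zero h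
      rw [Matrix.det_fin_two_of]
      field_simp
      ring⟩
  else 1

/-- The coordinates `(u, s)` of an element of `SL(2, ℝ)`, inverse to `shearSL`. -/
noncomputable def shearCoord (g : SL2) : (ℝ × ℝ) × ℝ :=
  ((-g 1 1, g 0 1), (g 0 0 * g 0 1 + g 1 0 * g 1 1) / (g 0 1 ^ 2 + g 1 1 ^ 2))

lemma coe_shearSL {z : (ℝ × ℝ) × ℝ} (hz : z.1 ≠ 0) :
    (shearSL z : Matrix (Fin 2) (Fin 2) ℝ) =
      !![-z.1.1 / (z.1.1 ^ 2 + z.1.2 ^ 2) + z.2 * z.1.2, z.1.2;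
        -z.1.2 / (z.1.1 ^ 2 + z.1.2 ^ 2) - z.2 * z.1.1, -z.1.1] :=
  congrArg Subtype.val (dif_pos hz)

lemma shearCoord_fst_ne_zero (g : SL2) : (shearCoord g).1 ≠ 0 := by
  intro h
  have h1 : -g 1 1 = 0 := congrArg Prod.fst h
  have h2 : g 0 1 = 0 := congrArg Prod.snd h
  have := SL2_det_eq_one g
  simp [h2, neg_eq_zero.1 h1] at this

lemma SL2_second_column_ne_zero (g : SL2) : g 0 1 ^ 2 + g 1 1 ^ 2 ≠ 0 := by
  have := sq_add_sq_ne_zero_of_ne_zero (shearCoord_fst_ne_zero g)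
  simpa [shearCoord, add_comm] using this

lemma shearSL_shearCoord (g : SL2) : shearSL (shearCoord g) = g := by
  have hd := SL2_det_eq_one g
  have hn := SL2_second_column_ne_zero g
  apply Subtype.ext
  rw [coe_shearSL (shearCoord_fst_ne_zero g)]
  ext i j
  fin_cases i <;> fin_cases j <;> simp [shearCoord]
  · rw [add_comm (g 1 1 ^ 2)]
    field_simp
    linear_combination (-g 1 1) * hd
  · rw [add_comm (g 1 1 ^ 2)]
    field_simp
    linear_combination (g 0 1) * hd

lemma shearCoord_shearSL {z : (ℝ × ℝ) × ℝ} (hz : z.1 ≠ 0) : shearCoord (shearSL z) = z := by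
  have hn := sq_add_sq_ne_zero_of_ne_zero hz
  rw [shearCoord, coe_shearSL hz]
  ext <;> simp
  rw [add_comm (z.1.2 ^ 2)]
  field_simp
  ring

lemma continuous_shearCoord : Continuous shearCoord := by
  have h := continuous_SL2_entry
  exact ((h 1 1).neg.prodMk (h 0 1)).prodMk
    ((((h 0 0).mul (h 0 1)).add ((h 1 0).mul (h 1 1))).div
      (((h 0 1).pow 2).add ((h 1 1).pow 2)) SL2_second_column_ne_zero)

lemma continuousAt_shearSL {z : (ℝ × ℝ) × ℝ} (hz : z.1 ≠ 0) : ContinuousAt shearSL z := by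
  have hn := sq_add_sq_ne_zero_of_ne_zero hz
  have hev : ∀ᶠ w : (ℝ × ℝ) × ℝ in 𝓝 z, w.1 ≠ 0 := continuous_fst.continuousAt.eventually_ne hz
  refine continuousAt_SL2_of_entries fun i j => ?_
  refine ContinuousAt.congr ?_ (hev.mono fun w hw => by
    show _ = (shearSL w : Matrix (Fin 2) (Fin 2) ℝ) i j
    rw [coe_shearSL hw])
  fin_cases i <;> fin_cases j <;> simp <;> fun_prop (disch := assumption)

lemma measurable_shearSL : Measurable shearSL := by
  classical
  refine measurable_SL2_of_entries fun i j => ?_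
  have heq : (fun z => shearSL z i j) = fun z : (ℝ × ℝ) × ℝ => if z.1 = 0 then
      (1 : Matrix (Fin 2) (Fin 2) ℝ) i j else
      !![-z.1.1 / (z.1.1 ^ 2 + z.1.2 ^ 2) + z.2 * z.1.2, z.1.2;
        -z.1.2 / (z.1.1 ^ 2 + z.1.2 ^ 2) - z.2 * z.1.1, -z.1.1] i j := by
    ext z
    split_ifs with hz
    · simp [shearSL, hz]
    · rw [coe_shearSL hz]
  rw [heq]
  refine Measurable.ite (measurable_fst (measurableSet_singleton 0)) measurable_const ?_
  fin_cases i <;> fin_cases j <;> simp <;> fun_prop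

lemma ae_fst_ne_zero : ∀ᵐ z : (ℝ × ℝ) × ℝ, z.1 ≠ 0 :=
  Measure.quasiMeasurePreserving_fst.ae (Measure.ae_ne volume 0)

/-- The contragredient action of `SL(2, ℝ)` on the plane preserves Lebesgue measure. -/
lemma measurePreserving_contragredient (g : SL2) :
    MeasurePreserving (fun u : ℝ × ℝ =>
      (g 1 1 * u.1 + -g 1 0 * u.2, -g 0 1 * u.1 + g 0 0 * u.2)) := by
  set L := Matrix.toLin (Module.Basis.finTwoProd ℝ) (Module.Basis.finTwoProd ℝ)
    !![g 1 1, -g 1 0; -g 0 1, g 0 0] with hL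
  have hdet : LinearMap.det L = 1 := by
    rw [hL, LinearMap.det_toLin, Matrix.det_fin_two_of]
    linear_combination SL2_det_eq_one g
  have hmap := Measure.map_linearMap_addHaar_eq_smul_addHaar (volume : Measure (ℝ × ℝ))
    (f := L) (by simp [hdet])
  have hfun : (L : ℝ × ℝ → ℝ × ℝ) = fun u =>
      (g 1 1 * u.1 + -g 1 0 * u.2, -g 0 1 * u.1 + g 0 0 * u.2) := by
    ext u <;> simp [hL, Matrix.toLin_finTwoProd_apply]
  refine ⟨by fun_prop, ?_⟩
  rw [← hfun, hmap, hdet]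
  simp

lemma shearCoord_mul_shearSL (g : SL2) {u : ℝ × ℝ} (hu : u ≠ 0) (s : ℝ) :
    shearCoord (g * shearSL (u, s)) =
      ((g 1 1 * u.1 + -g 1 0 * u.2, -g 0 1 * u.1 + g 0 0 * u.2),
        (shearCoord (g * shearSL (u, 0))).2 + s) := by
  have h0 := SL2_second_column_ne_zero (g * shearSL (u, 0))
  simp only [shearCoord, Matrix.SpecialLinearGroup.coe_mul, Matrix.mul_apply, Fin.sum_univ_two,
    coe_shearSL (z := (u, _)) hu] at h0 ⊢
  ext
  · simp
  · simp; ring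
  · simp at h0 ⊢
    rw [div_add' _ _ _ h0]
    congr 1
    ring

/-- Lebesgue measure in the coordinates `shearSL`, as a measure on `SL(2, ℝ)`. -/
noncomputable def shearMeasure : Measure SL2 := Measure.map shearSL volume

lemma shearMeasure_map_mul_left (g : SL2) :
    Measure.map (fun h => g * h) shearMeasure = shearMeasure := by
  have hS : MeasurePreserving (fun z : (ℝ × ℝ) × ℝ =>
      ((g 1 1 * z.1.1 + -g 1 0 * z.1.2, -g 0 1 * z.1.1 + g 0 0 * z.1.2),
        (shearCoord (g * shearSL (z.1, 0))).2 + z.2)) := by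
    refine (measurePreserving_contragredient g).skew_product (μc := volume) (μd := volume)
      (g := fun u s => (shearCoord (g * shearSL (u, 0))).2 + s) ?_
      (ae_of_all _ fun u => map_add_left_eq_self volume _)
    have hc : Measurable fun u : ℝ × ℝ => (shearCoord (g * shearSL (u, 0))).2 :=
      (continuous_snd.comp continuous_shearCoord).measurable.comp
        ((measurable_SL2_mul_left g).comp
          (measurable_shearSL.comp (measurable_id.prodMk measurable_const)))
    exact (hc.comp measurable_fst).add measurable_snd
  rw [shearMeasure, Measure.map_map (measurable_SL2_mul_left g) measurable_shearSL]
  conv_rhs => rw [← hS.map_eq, Measure.map_map measurable_shearSL hS.measurable]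
  refine Measure.map_congr ?_
  filter_upwards [ae_fst_ne_zero] with z hz
  simp only [Function.comp_apply]
  rw [← shearCoord_mul_shearSL g hz, shearSL_shearCoord]

theorem isHaarMeasure_shearMeasure : shearMeasure.IsHaarMeasure where
  lt_top_of_isCompact K hK := by
    have hσK : IsCompact (shearCoord '' K) := hK.image continuous_shearCoord
    calc shearMeasure K ≤ shearMeasure (shearCoord ⁻¹' (shearCoord '' K)) :=
          measure_mono (subset_preimage_image _ _)
      _ = volume (shearSL ⁻¹' (shearCoord ⁻¹' (shearCoord '' K))) :=
          Measure.map_apply measurable_shearSL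
            (continuous_shearCoord.measurable hσK.measurableSet)
      _ = volume (shearCoord '' K) := by
          refine measure_congr ?_
          filter_upwards [ae_fst_ne_zero] with z hz
          exact congrArg (fun w => w ∈ shearCoord '' K) (shearCoord_shearSL hz)
      _ < ⊤ := hσK.measure_lt_top
  map_mul_left_eq_self := shearMeasure_map_mul_left
  open_pos U hU := by
    rintro ⟨g, hg⟩
    rw [shearMeasure, Measure.map_apply measurable_shearSL hU.measurableSet]
    refine (Measure.measure_pos_of_mem_nhds volume (x := shearCoord g) ?_).ne'
    refine (continuousAt_shearSL (shearCoord_fst_ne_zero g)).preimage_mem_nhds ?_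
    rw [shearSL_shearCoord]
    exact hU.mem_nhds hg

/-! ### Comparison with the coordinates `k(θ) n(t) a(ν)` -/

lemma coe_aSL {ν : ℝ} (hν : ν ≠ 0) :
    (aSL ν : Matrix (Fin 2) (Fin 2) ℝ) = !![ν, 0; 0, ν⁻¹] :=
  congrArg Subtype.val (dif_pos hν)

lemma aSL_zero : aSL 0 = 1 := dif_neg (not_not.2 rfl)

lemma coe_kSL_mul_nSL (θ t : ℝ) :
    ((kSL θ * nSL t : SL2) : Matrix (Fin 2) (Fin 2) ℝ) =
      !![cos θ - sin θ * t, -sin θ; sin θ + cos θ * t, cos θ] := by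
  rw [Matrix.SpecialLinearGroup.coe_mul]
  ext i j
  fin_cases i <;> fin_cases j <;>
    simp [kSL, nSL, Matrix.mul_apply, Fin.sum_univ_two, sub_eq_add_neg]

lemma coe_Φ {p : ℝ × ℝ × ℝ} (hp : p.2.2 ≠ 0) :
    (Φ p : Matrix (Fin 2) (Fin 2) ℝ) =
      !![(cos p.1 - sin p.1 * p.2.1) * p.2.2, -sin p.1 * p.2.2⁻¹;
        (sin p.1 + cos p.1 * p.2.1) * p.2.2, cos p.1 * p.2.2⁻¹] := by
  rw [Φ, Matrix.SpecialLinearGroup.coe_mul, coe_kSL_mul_nSL, coe_aSL hp]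
  ext i j
  fin_cases i <;> fin_cases j <;> simp [Matrix.mul_apply, Fin.sum_univ_two]

lemma measurable_Φ : Measurable Φ := by
  classical
  refine measurable_SL2_of_entries fun i j => ?_
  have heq : (fun p => Φ p i j) = fun p : ℝ × ℝ × ℝ => if p.2.2 = 0 then
      !![cos p.1 - sin p.1 * p.2.1, -sin p.1; sin p.1 + cos p.1 * p.2.1, cos p.1] i j else
      !![(cos p.1 - sin p.1 * p.2.1) * p.2.2, -sin p.1 * p.2.2⁻¹;
        (sin p.1 + cos p.1 * p.2.1) * p.2.2, cos p.1 * p.2.2⁻¹] i j := by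
    ext p
    split_ifs with hp
    · rw [Φ, hp, aSL_zero, mul_one, coe_kSL_mul_nSL]
    · rw [coe_Φ hp]
  rw [heq]
  refine Measurable.ite ((measurable_snd.comp measurable_snd) (measurableSet_singleton 0)) ?_ ?_
  all_goals fin_cases i <;> fin_cases j <;> simp <;> fun_prop

lemma shearSL_polarCoord_symm {r : ℝ} (hr : 0 < r) (φ s : ℝ) :
    shearSL (polarCoord.symm (r, φ), s) = Φ (φ + π, r ^ 2 * s, r⁻¹) := by
  have hr' := hr.ne'
  have hsq : (r * cos φ) ^ 2 + (r * sin φ) ^ 2 = r ^ 2 := by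
    linear_combination r ^ 2 * sin_sq_add_cos_sq φ
  have hne : polarCoord.symm (r, φ) ≠ 0 := by
    intro h
    have h1 : r * cos φ = 0 := congrArg Prod.fst h
    have h2 : r * sin φ = 0 := congrArg Prod.snd h
    rw [h1, h2] at hsq
    exact hr' (by simpa using hsq.symm)
  apply Subtype.ext
  rw [coe_shearSL hne, coe_Φ (inv_ne_zero hr')]
  ext i j
  fin_cases i <;> fin_cases j <;> simp [hsq] <;> field_simp <;> ring

lemma lintegral_Ioi_eq_lintegral_Ioi_inv (F : ℝ → ENNReal) :
    ∫⁻ ν in Ioi 0, F ν = ∫⁻ r in Ioi 0, ENNReal.ofReal ((r ^ 2)⁻¹) * F r⁻¹ := by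
  have himage : (fun r : ℝ => r⁻¹) '' Ioi 0 = Ioi 0 := by
    ext x
    exact ⟨by rintro ⟨r, hr, rfl⟩; exact inv_pos.2 (mem_Ioi.1 hr),
      fun hx => ⟨x⁻¹, mem_Ioi.2 (inv_pos.2 hx), inv_inv x⟩⟩
  have h := lintegral_image_eq_lintegral_abs_deriv_mul (f := fun r : ℝ => r⁻¹) measurableSet_Ioi
    (fun r (hr : 0 < r) => (hasDerivAt_inv hr.ne').hasDerivWithinAt) inv_injective.injOn F
  rw [himage] at h
  rw [h]
  refine setLIntegral_congr_fun measurableSet_Ioi fun r _ => ?_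
  simp only [abs_neg, abs_inv, abs_pow, sq_abs]

lemma lintegral_eq_ofReal_mul_lintegral_comp_mul_left {c : ℝ} (hc : 0 < c) (F : ℝ → ENNReal) :
    ∫⁻ t, F t = ENNReal.ofReal c * ∫⁻ s, F (c * s) := by
  have himage : (fun s : ℝ => c * s) '' univ = univ :=
    image_univ_of_surjective (mul_left_surjective₀ hc.ne')
  have h := lintegral_image_eq_lintegral_abs_deriv_mul (f := fun s : ℝ => c * s)
    (f' := fun _ => c) MeasurableSet.univ
    (fun s _ => (by simpa using (hasDerivAt_id s).const_mul c : HasDerivAt _ c s).hasDerivWithinAt)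
    (mul_right_injective₀ hc.ne').injOn F
  rw [himage] at h
  simpa [abs_of_pos hc, lintegral_const_mul' _ _ ENNReal.ofReal_ne_top] using h

lemma lintegral_Ioo_zero_two_pi (F : ℝ → ENNReal) :
    ∫⁻ θ in Ioo 0 (2 * π), F θ = ∫⁻ φ in Ioo (-π) π, F (φ + π) := by
  have himage : (fun φ : ℝ => φ + π) '' Ioo (-π) π = Ioo 0 (2 * π) := by
    rw [image_add_const_Ioo, neg_add_cancel, two_mul]
  have h := lintegral_image_eq_lintegral_abs_deriv_mul (f := fun φ : ℝ => φ + π)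
    (f' := fun _ => 1) (s := Ioo (-π) π) measurableSet_Ioo
    (fun s _ => ((hasDerivAt_id s).add_const π).hasDerivWithinAt)
    (add_left_injective π).injOn F
  rw [himage] at h
  simpa using h

lemma lintegral_shearMeasure {f : SL2 → ENNReal} (hf : Measurable f) :
    ∫⁻ g, f g ∂shearMeasure = ∫⁻ r in Ioi 0, ∫⁻ φ in Ioo (-π) π,
      ENNReal.ofReal r * ∫⁻ s, f (Φ (φ + π, r ^ 2 * s, r⁻¹)) := by
  have hfΨ : Measurable fun z => f (shearSL z) := hf.comp measurable_shearSL
  have hfΦ : Measurable fun q : (ℝ × ℝ) × ℝ => f (Φ (q.1.2 + π, q.1.1 ^ 2 * q.2, q.1.1⁻¹)) :=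
    hf.comp (measurable_Φ.comp (by fun_prop))
  rw [shearMeasure, lintegral_map hf measurable_shearSL, Measure.volume_eq_prod,
    lintegral_prod _ hfΨ.aemeasurable, ← lintegral_comp_polarCoord_symm]
  have htarget : polarCoord.target = Ioi (0 : ℝ) ×ˢ Ioo (-π) π := rfl
  rw [htarget, setLIntegral_congr_fun (g := fun p : ℝ × ℝ =>
    ENNReal.ofReal p.1 * ∫⁻ s, f (Φ (p.2 + π, p.1 ^ 2 * s, p.1⁻¹)))
    (measurableSet_Ioi.prod measurableSet_Ioo), Measure.volume_eq_prod, setLIntegral_prod]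
  · exact ((by fun_prop : Measurable fun p : ℝ × ℝ => ENNReal.ofReal p.1).mul
      hfΦ.lintegral_prod_right').aemeasurable
  · rintro ⟨r, φ⟩ ⟨hr, -⟩
    simp only [smul_eq_mul, shearSL_polarCoord_symm hr]

lemma lintegral_kna {f : ℝ × ℝ × ℝ → ENNReal} (hf : Measurable f) :
    ∫⁻ p in Ioo 0 (2 * π) ×ˢ (univ : Set ℝ) ×ˢ Ioi (0 : ℝ), f p =
      ∫⁻ ν in Ioi 0, ∫⁻ θ in Ioo 0 (2 * π), ∫⁻ t, f (θ, t, ν) := by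
  rw [Measure.volume_eq_prod, setLIntegral_prod _ hf.aemeasurable]
  have hinner : ∀ θ : ℝ, ∫⁻ q in (univ : Set ℝ) ×ˢ Ioi (0 : ℝ), f (θ, q) =
      ∫⁻ ν in Ioi 0, ∫⁻ t, f (θ, t, ν) := by
    intro θ
    rw [Measure.volume_eq_prod,
      setLIntegral_prod_symm (fun q => f (θ, q)) (hf.comp measurable_prodMk_left).aemeasurable]
    simp only [Measure.restrict_univ]
  simp only [hinner]
  refine lintegral_lintegral_swap (Measurable.aemeasurable ?_)
  exact Measurable.lintegral_prod_right'
    (f := fun q : (ℝ × ℝ) × ℝ => f (q.1.1, q.2, q.1.2)) (hf.comp (by fun_prop))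

lemma map_Φ_eq_shearMeasure :
    Measure.map Φ
      (((volume : Measure (ℝ × ℝ × ℝ)).restrict
          (Ioo 0 (2 * π) ×ˢ (univ : Set ℝ) ×ˢ Ioi (0 : ℝ))).withDensity
        fun p => ENNReal.ofReal (1 / p.2.2)) = shearMeasure := by
  refine Measure.ext_of_lintegral _ fun f hf => ?_
  have hfΦ : Measurable fun p => f (Φ p) := hf.comp measurable_Φ
  have hd : Measurable fun p : ℝ × ℝ × ℝ => ENNReal.ofReal (1 / p.2.2) := by fun_prop
  rw [lintegral_map hf measurable_Φ, lintegral_withDensity_eq_lintegral_mul _ hd hfΦ,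
    lintegral_kna (hd.mul hfΦ), lintegral_Ioi_eq_lintegral_Ioi_inv, lintegral_shearMeasure hf]
  refine setLIntegral_congr_fun measurableSet_Ioi fun r (hr : 0 < r) => ?_
  have hr2 : 0 < r ^ 2 := by positivity
  simp only [lintegral_Ioo_zero_two_pi, Pi.mul_apply, one_div, inv_inv]
  rw [← lintegral_const_mul' _ _ ENNReal.ofReal_ne_top]
  refine lintegral_congr fun φ => ?_
  rw [lintegral_const_mul' _ _ ENNReal.ofReal_ne_top,
    lintegral_eq_ofReal_mul_lintegral_comp_mul_left hr2, ← mul_assoc, mul_left_comm, ← mul_assoc,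
    ← mul_assoc, ← ENNReal.ofReal_mul hr2.le, ← ENNReal.ofReal_mul (by positivity),
    mul_inv_cancel₀ hr2.ne', one_mul]

end

/-- The pushforward under `Φ : (θ, t, ν) ↦ k(θ) n(t) a(ν)`, defined on
`(0, 2π) × ℝ × (0, ∞)`, of the measure with density `1/ν` with respect to the Lebesgue
measure, is a left-invariant Haar measure on `SL(2, ℝ)`. -/
theorem haar_measure_in_kna_coordinates :
    (Measure.map Φ
      (((volume : Measure (ℝ × ℝ × ℝ)).restrict
          (Set.Ioo 0 (2 * π) ×ˢ (Set.univ : Set ℝ) ×ˢ Set.Ioi (0 : ℝ))).withDensity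
        fun p => ENNReal.ofReal (1 / p.2.2))).IsHaarMeasure := by
  rw [map_Φ_eq_shearMeasure]
  exact isHaarMeasure_shearMeasure
end
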